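/- arXiv:1709.10166 — 6 statements merged into one kernel-verified Lean document; each statement's English description precedes it below -/
import Mathlib

section
/- Let ν, σ ∈ ℝ with σ > 0 and |ν| < 1. For each ε > 0 let μ_ε be the Gaussian measure on ℝ with mean ν and variance ε·σ². Then lim_{ε→0⁺} ε·log μ_ε({x : |x| ≥ 1}) = −(1−|ν|)²/(2σ²). -/
open MeasureTheory ProbabilityTheory Filter Topology Set

lemma gauss_upper (ν : ℝ) (v : NNReal) (hv : v ≠ 0) (h0 : 0 ≤ ν) (h1 : ν < 1) :
    (gaussianReal ν v).real {x : ℝ | 1 ≤ |x|} ≤ 2 * Real.exp (-((1 - ν) ^ 2 / (2 * v))) := by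
  have hv0 : (0 : ℝ) < v := by positivity
  have ha : 0 ≤ (1 - ν) / v := div_nonneg (by linarith) hv0.le
  have hA := measure_ge_le_exp_mul_mgf (μ := gaussianReal ν v) (X := id) (t := (1 - ν) / v) 1 ha
    (integrable_exp_mul_gaussianReal _)
  have hB := measure_le_le_exp_mul_mgf (μ := gaussianReal ν v) (X := id) (t := -((1 - ν) / v)) (-1)
    (by linarith) (integrable_exp_mul_gaussianReal _)
  rw [mgf_id_gaussianReal, ← Real.exp_add] at hA hB
  have hsub : {x : ℝ | 1 ≤ |x|} ⊆ {x : ℝ | 1 ≤ id x} ∪ {x : ℝ | id x ≤ -1} := by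
    intro x hx
    rcases le_abs.1 (show 1 ≤ |x| from hx) with h | h
    · exact Or.inl h
    · exact Or.inr (show x ≤ -1 by linarith)
  have hA' := hA.trans (b := _) (Real.exp_le_exp.2 (show _ ≤ -((1 - ν) ^ 2 / (2 * (v:ℝ))) from by
    apply le_of_eq; field_simp; ring))
  have hB' := hB.trans (b := _) (Real.exp_le_exp.2 (show _ ≤ -((1 - ν) ^ 2 / (2 * (v:ℝ))) from by
    have : -((1 - ν) ^ 2 / (2 * (v:ℝ))) - (- -((1 - ν) / v) * -1 + (ν * -((1 - ν) / v)
      + v * (-((1 - ν) / v)) ^ 2 / 2)) = 2 * ν * ((1 - ν) / v) := by field_simp; ring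
    have h2 : 0 ≤ 2 * ν * ((1 - ν) / v) := by positivity
    linarith))
  calc _ ≤ _ := measureReal_mono hsub
    _ ≤ _ := measureReal_union_le _ _
    _ ≤ _ := by linarith

lemma gauss_lower (ν : ℝ) (v : NNReal) (hv : v ≠ 0) (h1 : ν < 1) (δ : ℝ) (hδ : 0 < δ) :
    δ * gaussianPDFReal ν v (1 + δ) ≤ (gaussianReal ν v).real {x : ℝ | 1 ≤ |x|} := by
  have hv0 : (0 : ℝ) < v := by positivity
  have hsub : Icc 1 (1 + δ) ⊆ {x : ℝ | 1 ≤ |x|} := fun x hx => hx.1.trans (le_abs_self x)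
  refine le_trans ?_ (measureReal_mono hsub)
  have hnn : 0 ≤ ∫ x in Icc 1 (1 + δ), gaussianPDFReal ν v x :=
    integral_nonneg fun x => gaussianPDFReal_nonneg _ _ _
  rw [measureReal_def, gaussianReal_apply_eq_integral _ hv, ENNReal.toReal_ofReal hnn]
  calc δ * gaussianPDFReal ν v (1 + δ)
      = ∫ x in Icc 1 (1 + δ), gaussianPDFReal ν v (1 + δ) := by
        simp [hδ.le]
    _ ≤ _ := by
        refine setIntegral_mono_on (by simp) (integrable_gaussianPDFReal _ _).integrableOn
          measurableSet_Icc ?_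
        intro x hx
        simp only [gaussianPDFReal]
        have : (x - ν) ^ 2 ≤ (1 + δ - ν) ^ 2 := by
          apply pow_le_pow_left₀ <;> linarith [hx.1, hx.2]
        gcongr

lemma ldp_nonneg (ν σ : ℝ) (hσ : 0 < σ) (h0 : 0 ≤ ν) (h1 : ν < 1) :
    Tendsto (fun ε : ℝ =>
        ε * Real.log ((gaussianReal ν (Real.toNNReal (ε * σ ^ 2))).real {x : ℝ | 1 ≤ |x|}))
      (𝓝[>] (0 : ℝ)) (𝓝 (-((1 - ν) ^ 2 / (2 * σ ^ 2)))) := by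
  have hid : Tendsto (fun ε : ℝ => ε) (𝓝[>] (0 : ℝ)) (𝓝 0) := tendsto_nhdsWithin_of_tendsto_nhds tendsto_id
  have hlog : Tendsto (fun ε : ℝ => Real.log ε * ε) (𝓝[>] (0 : ℝ)) (𝓝 0) :=
    by simpa using tendsto_log_mul_rpow_nhdsGT_zero (r := 1) one_pos
  have hlow : Tendsto (fun ε : ℝ => Real.log ε * ε / 2 - ε * (Real.log (2 * Real.pi * σ ^ 2) / 2)
      - (1 + ε - ν) ^ 2 / (2 * σ ^ 2)) (𝓝[>] (0 : ℝ)) (𝓝 (-((1 - ν) ^ 2 / (2 * σ ^ 2)))) := by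
    have := ((hlog.div_const 2).sub (hid.mul_const (Real.log (2 * Real.pi * σ ^ 2) / 2))).sub
      ((((hid.const_add 1).sub_const ν).pow 2).div_const (2 * σ ^ 2))
    convert this using 2
    ring
  have hup : Tendsto (fun ε : ℝ => ε * Real.log 2 - (1 - ν) ^ 2 / (2 * σ ^ 2))
      (𝓝[>] (0 : ℝ)) (𝓝 (-((1 - ν) ^ 2 / (2 * σ ^ 2)))) := by
    have := (hid.mul_const (Real.log 2)).sub_const ((1 - ν) ^ 2 / (2 * σ ^ 2))
    convert this using 2
    ring
  refine tendsto_of_tendsto_of_tendsto_of_le_of_le' hlow hup ?_ ?_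
  all_goals
    filter_upwards [self_mem_nhdsWithin] with ε hε
    have hε : 0 < ε := hε
    have hv0 : 0 < ε * σ ^ 2 := by positivity
    have hv : Real.toNNReal (ε * σ ^ 2) ≠ 0 := by simpa using hv0
    have hL := gauss_lower ν _ hv h1 ε hε
    have hpos : 0 < ε * gaussianPDFReal ν (Real.toNNReal (ε * σ ^ 2)) (1 + ε) :=
      mul_pos hε (gaussianPDFReal_pos _ _ _ hv)
  · refine le_trans (le_of_eq ?_) (mul_le_mul_of_nonneg_left (Real.log_le_log hpos hL) hε.le)
    rw [Real.log_mul hε.ne' (gaussianPDFReal_pos _ _ _ hv).ne', gaussianPDFReal,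
      Real.coe_toNNReal _ hv0.le, Real.log_mul (by positivity) (Real.exp_ne_zero _), Real.log_exp,
      Real.log_inv, Real.log_sqrt (by positivity),
      show 2 * Real.pi * (ε * σ ^ 2) = ε * (2 * Real.pi * σ ^ 2) by ring,
      Real.log_mul hε.ne' (by positivity)]
    field_simp
    ring
  · have hU := gauss_upper ν _ hv h0 h1
    refine le_trans (mul_le_mul_of_nonneg_left (Real.log_le_log (hpos.trans_le hL) hU) hε.le)
      (le_of_eq ?_)
    rw [Real.log_mul (by norm_num) (Real.exp_ne_zero _), Real.log_exp, Real.coe_toNNReal _ hv0.le]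
    field_simp
    ring

/-- Two-sided Gaussian overload large-deviations asymptotic: for the Gaussian measure on ℝ
with mean `ν`, `|ν| < 1`, and variance `ε σ²`,
`ε · log μ_ε {x | |x| ≥ 1} → −(1−|ν|)²/(2σ²)` as `ε → 0⁺`. -/
theorem gaussian_tail_ldp_two_sided (ν σ : ℝ) (hσ : 0 < σ) (hν : |ν| < 1) :
    Tendsto (fun ε : ℝ =>
        ε * Real.log ((gaussianReal ν (Real.toNNReal (ε * σ ^ 2)) {x : ℝ | 1 ≤ |x|}).toReal))
      (𝓝[>] (0 : ℝ)) (𝓝 (-((1 - |ν|) ^ 2 / (2 * σ ^ 2)))) := by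
  have key := ldp_nonneg |ν| σ hσ (abs_nonneg ν) hν
  have heq : ∀ v : NNReal, gaussianReal |ν| v {x : ℝ | 1 ≤ |x|}
      = gaussianReal ν v {x : ℝ | 1 ≤ |x|} := by
    intro v
    rcases abs_choice ν with h | h
    · rw [h]
    · rw [h, ← gaussianReal_map_neg, Measure.map_apply (by fun_prop)
        (show MeasurableSet {x : ℝ | 1 ≤ |x|} from
          measurableSet_le measurable_const continuous_abs.measurable)]
      simp
  simpa only [measureReal_def, heq] using key
end

section
/- Let n, m ≥ 1, let Σ_p ∈ ℝ^{n×n} be a positive definite symmetric matrix, V ∈ ℝ^{m×n}, μ ∈ ℝ^n, and ν = Vμ. Fix a line index ℓ with |ν_ℓ| < 1, ν_ℓ ≠ 0, and σ_ℓ² := (V Σ_p Vᵀ)_{ℓℓ} > 0. Define g(p) = ½ (p−μ)ᵀ Σ_p⁻¹ (p−μ). Then the infimum of g over the closed set {p ∈ ℝ^n : |(Vp)_ℓ| ≥ 1} equals (1−|ν_ℓ|)²/(2σ_ℓ²), and it is attained uniquely at the point p^{(ℓ)} = μ + ((sign(ν_ℓ)−ν_ℓ)/σ_ℓ²) · Σ_p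 Vᵀ e_ℓ, where sign(a) = 1 if a ≥ 0 and −1 otherwise, and e_ℓ is the ℓ-th standard basis vector of ℝ^m. -/
open Matrix

/-- `sign(a) = 1` if `a ≥ 0` and `−1` otherwise. -/
noncomputable def sgn (a : ℝ) : ℝ := if 0 ≤ a then 1 else -1

/-- The Gaussian rate function `g(p) = ½ (p−μ)ᵀ Σ_p⁻¹ (p−μ)` minimized over the overload set
`{p : |(Vp)_ℓ| ≥ 1}` has infimum `(1−|ν_ℓ|)²/(2σ_ℓ²)`, attained uniquely at
`p^{(ℓ)} = μ + ((sign(ν_ℓ)−ν_ℓ)/σ_ℓ²) Σ_p Vᵀ e_ℓ` (Proposition 1). -/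
theorem rate_function_overload_min (n m : ℕ) (hn : 1 ≤ n) (hm : 1 ≤ m)
    (Sp : Matrix (Fin n) (Fin n) ℝ) (hSp : Sp.PosDef)
    (V : Matrix (Fin m) (Fin n) ℝ) (μ : Fin n → ℝ)
    (ν : Fin m → ℝ) (hν : ν = V.mulVec μ)
    (ℓ : Fin m) (hℓ : |ν ℓ| < 1) (hℓ0 : ν ℓ ≠ 0)
    (σsq : ℝ) (hσdef : σsq = (V * Sp * Vᵀ) ℓ ℓ) (hσpos : 0 < σsq)
    (g : (Fin n → ℝ) → ℝ)
    (hg : ∀ p, g p = (1 / 2) * ((p - μ) ⬝ᵥ (Sp⁻¹).mulVec (p - μ)))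
    (pstar : Fin n → ℝ)
    (hpstar : pstar = μ + ((sgn (ν ℓ) - ν ℓ) / σsq) • Sp.mulVec (Vᵀ.mulVec (Pi.single ℓ 1))) :
    1 ≤ |V.mulVec pstar ℓ| ∧
      g pstar = (1 - |ν ℓ|) ^ 2 / (2 * σsq) ∧
      ∀ p : Fin n → ℝ, 1 ≤ |V.mulVec p ℓ| →
        g pstar ≤ g p ∧ (g p = g pstar → p = pstar) := by
  set w : Fin n → ℝ := Vᵀ.mulVec (Pi.single ℓ 1) with hw
  have hwd : ∀ d : Fin n → ℝ, V.mulVec d ℓ = w ⬝ᵥ d := by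
    intro d
    simp [hw, Matrix.mulVec, dotProduct, Matrix.transpose_apply]
  have hdet : IsUnit Sp.det := (Matrix.isUnit_iff_isUnit_det _).1 hSp.isUnit
  have hinv : Sp⁻¹.mulVec (Sp.mulVec w) = w := by
    rw [Matrix.mulVec_mulVec, Matrix.nonsing_inv_mul _ hdet, Matrix.one_mulVec]
  have hσ : w ⬝ᵥ Sp.mulVec w = σsq := by
    rw [← hwd, hσdef, Matrix.mulVec_mulVec, hw, Matrix.mulVec_mulVec]
    simp
  have hPI : (Sp⁻¹).PosDef := hSp.inv
  have hsymm : ∀ x y : Fin n → ℝ, x ⬝ᵥ Sp⁻¹.mulVec y = y ⬝ᵥ Sp⁻¹.mulVec x := by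
    intro x y
    have ht : (Sp⁻¹)ᵀ = Sp⁻¹ := by
      have := hPI.isHermitian.eq
      rwa [Matrix.conjTranspose_eq_transpose_of_trivial] at this
    rw [Matrix.dotProduct_mulVec, ← Matrix.mulVec_transpose, ht, dotProduct_comm]
  have hpos : ∀ x : Fin n → ℝ, x ≠ 0 → 0 < x ⬝ᵥ Sp⁻¹.mulVec x := by
    intro x hx
    simpa using hPI.dotProduct_mulVec_pos hx
  have hnn : ∀ x : Fin n → ℝ, 0 ≤ x ⬝ᵥ Sp⁻¹.mulVec x := by
    intro x
    by_cases hx : x = 0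
    · simp [hx]
    · exact (hpos x hx).le
  have hQ : ∀ (d : Fin n → ℝ), d ⬝ᵥ Sp⁻¹.mulVec d =
      (d - ((w ⬝ᵥ d) / σsq) • Sp.mulVec w) ⬝ᵥ
        Sp⁻¹.mulVec (d - ((w ⬝ᵥ d) / σsq) • Sp.mulVec w) + (w ⬝ᵥ d) ^ 2 / σsq := by
    intro d
    have h1 : Sp.mulVec w ⬝ᵥ Sp⁻¹.mulVec d = w ⬝ᵥ d := by
      rw [hsymm, hinv, dotProduct_comm]
    have h2 : Sp.mulVec w ⬝ᵥ w = σsq := by rw [dotProduct_comm, hσ]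
    simp only [Matrix.mulVec_sub, Matrix.mulVec_smul, hinv, sub_dotProduct, dotProduct_sub,
      smul_dotProduct, dotProduct_smul, h1, h2, smul_eq_mul, dotProduct_comm d w]
    field_simp
    ring
  have hs : sgn (ν ℓ) * ν ℓ = |ν ℓ| ∧ sgn (ν ℓ) ^ 2 = 1 := by
    unfold sgn
    split_ifs with h
    · simp [abs_of_nonneg h]
    · simp [abs_of_neg (not_le.1 h)]
  obtain ⟨hs1, hs2⟩ := hs
  have hVs : V.mulVec pstar ℓ = sgn (ν ℓ) := by
    rw [hpstar, Matrix.mulVec_add, Matrix.mulVec_smul, Pi.add_apply, Pi.smul_apply, hwd (Sp.mulVec w),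
      hσ, ← hν, smul_eq_mul]
    field_simp
    ring
  have hgs : g pstar = (1 - |ν ℓ|) ^ 2 / (2 * σsq) := by
    have h2 : Sp.mulVec w ⬝ᵥ w = σsq := by rw [dotProduct_comm, hσ]
    rw [hg, hpstar, add_sub_cancel_left, Matrix.mulVec_smul, hinv, smul_dotProduct,
      dotProduct_smul, h2, smul_eq_mul, smul_eq_mul]
    have : (1 - |ν ℓ|) ^ 2 = (sgn (ν ℓ) - ν ℓ) ^ 2 := by
      have := sq_abs (ν ℓ)
      nlinarith
    rw [this]
    field_simp
  refine ⟨?_, hgs, ?_⟩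
  · rw [hVs]
    have := sq_abs (sgn (ν ℓ))
    nlinarith [abs_nonneg (sgn (ν ℓ))]
  intro p hp
  have hwp : w ⬝ᵥ (p - μ) = V.mulVec p ℓ - ν ℓ := by
    rw [← hwd, Matrix.mulVec_sub, Pi.sub_apply, ← hν]
  have hgp := hg p
  rw [hQ, hwp] at hgp
  have hr := hnn (p - μ - ((V.mulVec p ℓ - ν ℓ) / σsq) • Sp.mulVec w)
  have hle : (1 - |ν ℓ|) ^ 2 ≤ (V.mulVec p ℓ - ν ℓ) ^ 2 := by
    rw [← sq_abs (V.mulVec p ℓ - ν ℓ)]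
    have := abs_sub_abs_le_abs_sub (V.mulVec p ℓ) (ν ℓ)
    apply pow_le_pow_left₀ <;> linarith
  have hle2 : (1 - |ν ℓ|) ^ 2 / σsq ≤ (V.mulVec p ℓ - ν ℓ) ^ 2 / σsq := by gcongr
  have hgs2 : g pstar = (1 / 2) * ((1 - |ν ℓ|) ^ 2 / σsq) := by
    rw [hgs]; field_simp
  refine ⟨by linarith, fun heq => ?_⟩
  have e1 : (V.mulVec p ℓ - ν ℓ) ^ 2 / σsq = (1 - |ν ℓ|) ^ 2 / σsq := by linarith
  have e2 : (V.mulVec p ℓ - ν ℓ) ^ 2 = (1 - |ν ℓ|) ^ 2 := by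
    field_simp at e1
    exact e1
  have e3 : p - μ - ((V.mulVec p ℓ - ν ℓ) / σsq) • Sp.mulVec w = 0 := by
    by_contra hne
    have := hpos _ hne
    linarith
  have e4 : V.mulVec p ℓ = sgn (ν ℓ) := by
    generalize V.mulVec p ℓ = y at *
    have hn0 := abs_pos.2 hℓ0
    rcases sq_eq_sq_iff_eq_or_eq_neg.1 e2 with h | h <;> unfold sgn <;> split_ifs with h0 <;>
    [rw [abs_of_nonneg h0] at *; rw [abs_of_neg (not_le.1 h0)] at *;
     rw [abs_of_nonneg h0] at *; rw [abs_of_neg (not_le.1 h0)] at *] <;>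
    rcases le_abs.1 hp with h' | h' <;> linarith
  rw [e4] at e3
  rw [hpstar, ← sub_eq_zero, ← e3]
  abel
end

section
/- Let Σ_p ∈ ℝ^{n×n} be positive definite symmetric, V ∈ ℝ^{m×n}, μ ∈ ℝ^n, ν = Vμ with max_{j=1,…,m} |ν_j| < 1, and assume σ_ℓ² := (V Σ_p Vᵀ)_{ℓℓ} > 0 for every line ℓ = 1,…,m. For ε > 0, let p_ε be a random vector with the multivariate Gaussian distribution N(μ, ε Σ_p) on ℝ^n and set f_ε = V p_ε. Then lim_{ε→0⁺} ε·log ℙ(max_{ℓ=1,…,m} |(f_ε)_ℓ| ≥ 1) = −min_{ℓ=1,…,m} (1−|ν_ℓ|)²/(2σ_ℓ²). -/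
open Matrix MeasureTheory Filter Topology Set

/-- The multivariate Gaussian measure on `ℝⁿ` with mean `μ` and (positive definite)
covariance matrix `S`, defined through its density with respect to Lebesgue measure. -/
noncomputable def mvGaussian {n : ℕ} (μ : Fin n → ℝ) (S : Matrix (Fin n) (Fin n) ℝ) :
    Measure (Fin n → ℝ) :=
  volume.withDensity fun x =>
    ENNReal.ofReal ((Real.sqrt ((2 * Real.pi) ^ n * S.det))⁻¹ *
      Real.exp (-(1 / 2) * ((x - μ) ⬝ᵥ (S⁻¹).mulVec (x - μ))))


lemma quad_expand {n : ℕ} {S : Matrix (Fin n) (Fin n) ℝ} (hS : S.PosDef)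
    (u z : Fin n → ℝ) (k r : ℝ) :
    (k • S.mulVec u + r • z) ⬝ᵥ (S⁻¹).mulVec (k • S.mulVec u + r • z) =
      k ^ 2 * (u ⬝ᵥ S.mulVec u) + 2 * k * r * (u ⬝ᵥ z) + r ^ 2 * (z ⬝ᵥ (S⁻¹).mulVec z) := by
  have hdet : IsUnit S.det := hS.det_pos.ne'.isUnit
  have hT : Sᵀ = S := by
    have h := hS.isHermitian
    rwa [Matrix.IsHermitian, Matrix.conjTranspose_eq_transpose_of_trivial] at h
  have h1 : (S⁻¹).mulVec (S.mulVec u) = u := by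
    rw [Matrix.mulVec_mulVec, Matrix.nonsing_inv_mul _ hdet, Matrix.one_mulVec]
  have h2 : (S.mulVec u) ⬝ᵥ (S⁻¹).mulVec z = u ⬝ᵥ z := by
    have : S.mulVec u = Matrix.vecMul u S := by rw [← Matrix.mulVec_transpose, hT]
    rw [this, ← Matrix.dotProduct_mulVec, Matrix.mulVec_mulVec, Matrix.mul_nonsing_inv _ hdet,
      Matrix.one_mulVec]
  simp only [Matrix.mulVec_add, Matrix.mulVec_smul, add_dotProduct, dotProduct_add,
    smul_dotProduct, dotProduct_smul, h1, h2, smul_eq_mul]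
  rw [dotProduct_comm (S.mulVec u) u, dotProduct_comm z u]
  ring

lemma quad_nonneg {n : ℕ} {S : Matrix (Fin n) (Fin n) ℝ} (hS : S.PosDef) (z : Fin n → ℝ) :
    0 ≤ z ⬝ᵥ (S⁻¹).mulVec z := by
  simpa using hS.inv.posSemidef.dotProduct_mulVec_nonneg z

lemma quad_coercive {n : ℕ} {S : Matrix (Fin n) (Fin n) ℝ} (hS : S.PosDef) :
    ∃ b : ℝ, 0 < b ∧ ∀ z : Fin n → ℝ, b * ∑ i, z i ^ 2 ≤ z ⬝ᵥ (S⁻¹).mulVec z := by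
  have hd : ∀ i, 0 < S i i := fun i => hS.diag_pos
  have hs : 0 ≤ ∑ i, S i i := Finset.sum_nonneg fun i _ => (hd i).le
  refine ⟨(∑ i, S i i + 1)⁻¹, by positivity, fun z => ?_⟩
  have hQ := quad_nonneg hS z
  have key : ∀ i, z i ^ 2 ≤ S i i * (z ⬝ᵥ (S⁻¹).mulVec z) := by
    intro i
    have h := quad_nonneg hS ((-(z i)) • S.mulVec (Pi.single i 1) + (S i i) • z)
    rw [quad_expand hS] at h
    have e1 : (Pi.single i (1 : ℝ)) ⬝ᵥ S.mulVec (Pi.single i 1) = S i i := by simp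
    have e2 : (Pi.single i (1 : ℝ)) ⬝ᵥ z = z i := by simp
    rw [e1, e2] at h
    have h' : 0 ≤ S i i * (S i i * (z ⬝ᵥ (S⁻¹).mulVec z) - z i ^ 2) := by
      nlinarith
    have := nonneg_of_mul_nonneg_right h' (hd i)
    linarith
  rw [inv_mul_le_iff₀ (by positivity)]
  calc ∑ i, z i ^ 2 ≤ ∑ i, S i i * (z ⬝ᵥ (S⁻¹).mulVec z) := Finset.sum_le_sum fun i _ => key i
    _ = (∑ i, S i i) * (z ⬝ᵥ (S⁻¹).mulVec z) := by rw [Finset.sum_mul]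
    _ ≤ _ := by nlinarith

noncomputable def stdDens {n : ℕ} (S : Matrix (Fin n) (Fin n) ℝ) (z : Fin n → ℝ) : ℝ :=
  (Real.sqrt ((2 * Real.pi) ^ n * S.det))⁻¹ *
      Real.exp (-(1 / 2) * (z ⬝ᵥ (S⁻¹).mulVec z))

lemma quad_continuous {n : ℕ} (S : Matrix (Fin n) (Fin n) ℝ) :
    Continuous fun z : Fin n → ℝ => z ⬝ᵥ S.mulVec z := by
  simp only [dotProduct, Matrix.mulVec]
  fun_prop

lemma stdDens_continuous {n : ℕ} (S : Matrix (Fin n) (Fin n) ℝ) : Continuous (stdDens S) := by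
  have := quad_continuous S⁻¹
  unfold stdDens
  fun_prop

lemma stdDens_pos {n : ℕ} {S : Matrix (Fin n) (Fin n) ℝ} (hS : S.PosDef) (z : Fin n → ℝ) :
    0 < stdDens S z := by
  have := hS.det_pos
  unfold stdDens
  positivity

lemma stdDens_integrable {n : ℕ} {S : Matrix (Fin n) (Fin n) ℝ} (hS : S.PosDef) :
    Integrable (stdDens S) := by
  obtain ⟨b, hb, hQ⟩ := quad_coercive hS
  have h1 : Integrable (fun x : Fin n → ℝ => ∏ i, Real.exp (-(b / 2) * (x i) ^ 2)) :=
    Integrable.fintype_prod (f := fun _ (x : ℝ) => Real.exp (-(b / 2) * x ^ 2))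
      fun _ => integrable_exp_neg_mul_sq (by positivity)
  refine (h1.const_mul ((Real.sqrt ((2 * Real.pi) ^ n * S.det))⁻¹)).mono'
    (stdDens_continuous S).aestronglyMeasurable (Eventually.of_forall fun z => ?_)
  rw [Real.norm_eq_abs, abs_of_pos (stdDens_pos hS z), stdDens, ← Real.exp_sum, ← Finset.mul_sum]
  have := hQ z
  refine mul_le_mul_of_nonneg_left (Real.exp_le_exp.2 ?_) (by positivity)
  linarith

lemma halfspace_eq {n : ℕ} {S : Matrix (Fin n) (Fin n) ℝ} (hS : S.PosDef)
    (μ u : Fin n → ℝ) (hσ : 0 < u ⬝ᵥ S.mulVec u) {ε : ℝ} (hε : 0 < ε) :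
    mvGaussian μ (ε • S) {x | 1 ≤ u ⬝ᵥ x} =
      ∫⁻ z in {z | 0 ≤ u ⬝ᵥ z}, ENNReal.ofReal
        (Real.exp (-((1 - u ⬝ᵥ μ) ^ 2 / (2 * (u ⬝ᵥ S.mulVec u))) / ε) *
          Real.exp (-((1 - u ⬝ᵥ μ) / (u ⬝ᵥ S.mulVec u) / Real.sqrt ε * (u ⬝ᵥ z))) *
          stdDens S z) := by
  have hcont : Continuous fun x : Fin n → ℝ => u ⬝ᵥ x := by
    simp only [dotProduct]; fun_prop
  have hm1 : MeasurableSet {x : Fin n → ℝ | 1 ≤ u ⬝ᵥ x} :=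
    (isClosed_le continuous_const hcont).measurableSet
  have hm0 : MeasurableSet {x : Fin n → ℝ | 0 ≤ u ⬝ᵥ x} :=
    (isClosed_le continuous_const hcont).measurableSet
  set σ2 := u ⬝ᵥ S.mulVec u with hσ2
  set a := 1 - u ⬝ᵥ μ with ha
  have hr : 0 < Real.sqrt ε := Real.sqrt_pos.2 hε
  set r := Real.sqrt ε with hrdef
  have hr2 : r ^ 2 = ε := Real.sq_sqrt hε.le
  set b : Fin n → ℝ := μ + (a / σ2) • S.mulVec u with hb
  rw [mvGaussian, withDensity_apply _ hm1, ← lintegral_indicator hm1, ← lintegral_indicator hm0]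
  rw [← lintegral_add_left_eq_self _ b]
  have hscale : ∀ F : (Fin n → ℝ) → ENNReal,
      ∫⁻ x, F x = ∫⁻ z, ENNReal.ofReal (r ^ n) * F (r • z) := by
    intro F
    have hemb : MeasurableEmbedding (fun x : Fin n → ℝ => r • x) :=
      (Homeomorph.smulOfNeZero r hr.ne').measurableEmbedding
    have h := hemb.lintegral_map (μ := volume) F
    rw [Measure.map_addHaar_smul _ hr.ne', lintegral_smul_measure] at h
    rw [lintegral_const_mul' _ _ ENNReal.ofReal_ne_top, ← h, smul_eq_mul, ← mul_assoc,
      ← ENNReal.ofReal_mul (by positivity)]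
    rw [abs_of_pos (by positivity)]
    simp [hr.ne']
  rw [hscale]
  refine lintegral_congr fun z => ?_
  have hub : u ⬝ᵥ b = 1 := by
    rw [hb, dotProduct_add, dotProduct_smul, smul_eq_mul, ← hσ2]
    field_simp
    rw [ha]; ring
  have hmem : (b + r • z ∈ {x : Fin n → ℝ | 1 ≤ u ⬝ᵥ x}) ↔ z ∈ {z : Fin n → ℝ | 0 ≤ u ⬝ᵥ z} := by
    simp only [mem_ofPred_eq, dotProduct_add, hub, dotProduct_smul, smul_eq_mul]
    constructor
    · intro h
      exact nonneg_of_mul_nonneg_right (by linarith : 0 ≤ r * (u ⬝ᵥ z)) hr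
    · intro h
      have := mul_nonneg hr.le h
      linarith
  by_cases hz : z ∈ {z : Fin n → ℝ | 0 ≤ u ⬝ᵥ z}
  · rw [indicator_of_mem (hmem.2 hz), indicator_of_mem hz, ← ENNReal.ofReal_mul (by positivity)]
    congr 1
    have hsub : b + r • z - μ = (a / σ2) • S.mulVec u + r • z := by rw [hb]; abel
    have hinv : (ε • S)⁻¹ = ε⁻¹ • S⁻¹ := by
      have := Matrix.inv_smul' S (Units.mk0 ε hε.ne') hS.det_pos.ne'.isUnit
      simpa [Units.smul_def] using this
    rw [hsub, hinv, Matrix.smul_mulVec, dotProduct_smul, quad_expand hS, Matrix.det_smul,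
      Fintype.card_fin, stdDens, ← hσ2]
    have hsq : Real.sqrt ((2 * Real.pi) ^ n * (ε ^ n * S.det)) =
        r ^ n * Real.sqrt ((2 * Real.pi) ^ n * S.det) := by
      rw [show (2 * Real.pi) ^ n * (ε ^ n * S.det) = (r ^ n) ^ 2 * ((2 * Real.pi) ^ n * S.det) by
        rw [← hr2]; ring]
      rw [Real.sqrt_mul (by positivity), Real.sqrt_sq (by positivity)]
    rw [hsq, mul_inv]
    have hexp : ∀ A B C c : ℝ, Real.exp A * Real.exp B * (c * Real.exp C) =
        c * Real.exp (A + B + C) := by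
      intro A B C c; rw [Real.exp_add, Real.exp_add]; ring
    rw [hexp, mul_assoc, ← mul_assoc (r ^ n), mul_inv_cancel₀ (by positivity), one_mul]
    congr 2
    rw [smul_eq_mul, ← hr2]
    field_simp
    ring
  · rw [indicator_of_notMem (fun h => hz (hmem.1 h)), indicator_of_notMem hz, mul_zero]

lemma halfspace_upper {n : ℕ} {S : Matrix (Fin n) (Fin n) ℝ} (hS : S.PosDef)
    (μ u : Fin n → ℝ) (hσ : 0 < u ⬝ᵥ S.mulVec u) (hu : u ⬝ᵥ μ < 1) {ε : ℝ} (hε : 0 < ε) :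
    mvGaussian μ (ε • S) {x | 1 ≤ u ⬝ᵥ x} ≤
      ENNReal.ofReal (Real.exp (-((1 - u ⬝ᵥ μ) ^ 2 / (2 * (u ⬝ᵥ S.mulVec u))) / ε) *
        ∫ z, stdDens S z) := by
  have hcont : Continuous fun x : Fin n → ℝ => u ⬝ᵥ x := by
    simp only [dotProduct]; fun_prop
  have hm0 : MeasurableSet {x : Fin n → ℝ | 0 ≤ u ⬝ᵥ x} :=
    (isClosed_le continuous_const hcont).measurableSet
  rw [halfspace_eq hS μ u hσ hε, ENNReal.ofReal_mul (by positivity),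
    ofReal_integral_eq_lintegral_ofReal (stdDens_integrable hS)
      (Eventually.of_forall fun z => (stdDens_pos hS z).le),
    ← lintegral_const_mul' _ _ ENNReal.ofReal_ne_top]
  refine le_trans (setLIntegral_mono' hm0 fun z hz => ?_) (setLIntegral_le_lintegral _ _)
  rw [← ENNReal.ofReal_mul (by positivity)]
  refine ENNReal.ofReal_le_ofReal ?_
  refine mul_le_mul_of_nonneg_right ?_ (stdDens_pos hS z).le
  refine mul_le_of_le_one_right (by positivity) ?_
  rw [Real.exp_le_one_iff, neg_nonpos]
  have h1 : 0 < 1 - u ⬝ᵥ μ := by linarith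
  have h2 : 0 ≤ u ⬝ᵥ z := hz
  positivity

lemma halfspace_lower {n : ℕ} {S : Matrix (Fin n) (Fin n) ℝ} (hS : S.PosDef)
    (μ u : Fin n → ℝ) (hσ : 0 < u ⬝ᵥ S.mulVec u) (hu : u ⬝ᵥ μ < 1) :
    ∃ K κ : ℝ, 0 < K ∧ ∀ ε : ℝ, 0 < ε →
      ENNReal.ofReal (Real.exp (-((1 - u ⬝ᵥ μ) ^ 2 / (2 * (u ⬝ᵥ S.mulVec u))) / ε) *
        Real.exp (-(κ / Real.sqrt ε)) * K) ≤ mvGaussian μ (ε • S) {x | 1 ≤ u ⬝ᵥ x} := by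
  have hcont : Continuous fun x : Fin n → ℝ => u ⬝ᵥ x := by
    simp only [dotProduct]; fun_prop
  set C : Set (Fin n → ℝ) := {z | 0 < u ⬝ᵥ z ∧ u ⬝ᵥ z < 1} with hC
  have hCo : IsOpen C :=
    (isOpen_lt continuous_const hcont).inter (isOpen_lt hcont continuous_const)
  have hCne : C.Nonempty := by
    refine ⟨(1 / (2 * (u ⬝ᵥ S.mulVec u))) • S.mulVec u, ?_⟩
    have : u ⬝ᵥ ((1 / (2 * (u ⬝ᵥ S.mulVec u))) • S.mulVec u) = 1 / 2 := by
      rw [dotProduct_smul, smul_eq_mul]; field_simp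
    simp only [hC, mem_ofPred_eq, this]
    norm_num
  refine ⟨∫ z in C, stdDens S z, (1 - u ⬝ᵥ μ) / (u ⬝ᵥ S.mulVec u), ?_, ?_⟩
  · rw [setIntegral_pos_iff_support_of_nonneg_ae
      (Eventually.of_forall fun z => (stdDens_pos hS z).le) (stdDens_integrable hS).integrableOn]
    have : Function.support (stdDens S) = univ := by
      ext z; simp [(stdDens_pos hS z).ne']
    rw [this, univ_inter]
    exact hCo.measure_pos _ hCne
  · intro ε hε
    rw [halfspace_eq hS μ u hσ hε, ENNReal.ofReal_mul (by positivity),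
      ofReal_integral_eq_lintegral_ofReal (stdDens_integrable hS).integrableOn
        (Eventually.of_forall fun z => (stdDens_pos hS z).le),
      ← lintegral_const_mul' _ _ ENNReal.ofReal_ne_top]
    refine le_trans (setLIntegral_mono' hCo.measurableSet fun z hz => ?_)
      (lintegral_mono_set (fun z hz => hz.1.le))
    rw [← ENNReal.ofReal_mul (by positivity)]
    refine ENNReal.ofReal_le_ofReal ?_
    refine mul_le_mul_of_nonneg_right ?_ (stdDens_pos hS z).le
    refine mul_le_mul_of_nonneg_left ?_ (by positivity)
    rw [Real.exp_le_exp, neg_le_neg_iff]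
    have h1 : 0 < 1 - u ⬝ᵥ μ := by linarith
    exact mul_le_of_le_one_right (by positivity) hz.2.le

lemma log_squeeze (p : ℝ → ℝ) (I κ K K' : ℝ) (hK : 0 < K) (hK' : 0 < K')
    (hlo : ∀ ε, 0 < ε → Real.exp (-I / ε) * Real.exp (-(κ / Real.sqrt ε)) * K ≤ p ε)
    (hup : ∀ ε, 0 < ε → p ε ≤ Real.exp (-I / ε) * K') :
    Tendsto (fun ε => ε * Real.log (p ε)) (𝓝[>] 0) (𝓝 (-I)) := by
  have l1 : Tendsto (fun ε : ℝ => -I - κ * Real.sqrt ε + ε * Real.log K) (𝓝[>] 0) (𝓝 (-I)) := by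
    have : Continuous (fun ε : ℝ => -I - κ * Real.sqrt ε + ε * Real.log K) := by fun_prop
    have h := (this.tendsto 0).mono_left (nhdsWithin_le_nhds (s := Ioi 0))
    simpa using h
  have l2 : Tendsto (fun ε : ℝ => -I + ε * Real.log K') (𝓝[>] 0) (𝓝 (-I)) := by
    have : Continuous (fun ε : ℝ => -I + ε * Real.log K') := by fun_prop
    have h := (this.tendsto 0).mono_left (nhdsWithin_le_nhds (s := Ioi 0))
    simpa using h
  refine tendsto_of_tendsto_of_tendsto_of_le_of_le' l1 l2 ?_ ?_
  · filter_upwards [self_mem_nhdsWithin] with ε (hε : 0 < ε)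
    have h := Real.log_le_log (by positivity) (hlo ε hε)
    rw [Real.log_mul (by positivity) hK.ne', ← Real.exp_add, Real.log_exp] at h
    have h2 := mul_le_mul_of_nonneg_left h hε.le
    refine le_trans (le_of_eq ?_) h2
    have hs : Real.sqrt ε ^ 2 = ε := Real.sq_sqrt hε.le
    have hr : 0 < Real.sqrt ε := Real.sqrt_pos.2 hε
    have e1 : ε * (κ / Real.sqrt ε) = κ * Real.sqrt ε := by
      field_simp; rw [hs]; ring
    have e2 : ε * (-I / ε) = -I := by field_simp
    rw [mul_add, mul_add, mul_neg, e1, e2]; ring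
  · filter_upwards [self_mem_nhdsWithin] with ε (hε : 0 < ε)
    have hp : 0 < p ε := lt_of_lt_of_le (by positivity) (hlo ε hε)
    have h := Real.log_le_log hp (hup ε hε)
    rw [Real.log_mul (by positivity) hK'.ne', Real.log_exp] at h
    have h2 := mul_le_mul_of_nonneg_left h hε.le
    refine le_trans h2 (le_of_eq ?_)
    have e2 : ε * (-I / ε) = -I := by field_simp
    rw [mul_add, e2]

lemma stdDens_integral_pos {n : ℕ} {S : Matrix (Fin n) (Fin n) ℝ} (hS : S.PosDef) :
    0 < ∫ z, stdDens S z := by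
  rw [integral_pos_iff_support_of_nonneg (fun z => (stdDens_pos hS z).le) (stdDens_integrable hS)]
  have : Function.support (stdDens S) = univ := by
    ext z; simp [(stdDens_pos hS z).ne']
  rw [this]
  exact isOpen_univ.measure_pos _ univ_nonempty

/-- Large deviations principle for the first emergent line failure:
`ε · log ℙ(max_ℓ |(f_ε)_ℓ| ≥ 1) → −min_ℓ (1−|ν_ℓ|)²/(2σ_ℓ²)` as `ε → 0⁺`,
where `f_ε = V p_ε` and `p_ε ∼ N(μ, ε Σ_p)`. -/
theorem first_failure_ldp (n m : ℕ) (hn : 1 ≤ n) (hm : 1 ≤ m)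
    (Sp : Matrix (Fin n) (Fin n) ℝ) (hSp : Sp.PosDef)
    (V : Matrix (Fin m) (Fin n) ℝ) (μ : Fin n → ℝ)
    (ν : Fin m → ℝ) (hν : ν = V.mulVec μ)
    (hνlt : ∀ j : Fin m, |ν j| < 1)
    (hσpos : ∀ ℓ : Fin m, 0 < (V * Sp * Vᵀ) ℓ ℓ) :
    Tendsto (fun ε : ℝ =>
        ε * Real.log ((mvGaussian μ (ε • Sp) {x | ∃ ℓ : Fin m, 1 ≤ |V.mulVec x ℓ|}).toReal))
      (𝓝[>] (0 : ℝ))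
      (𝓝 (-(⨅ ℓ : Fin m, (1 - |ν ℓ|) ^ 2 / (2 * (V * Sp * Vᵀ) ℓ ℓ)))) := by
  have : Nonempty (Fin m) := ⟨⟨0, hm⟩⟩
  have hνe : ∀ ℓ, V ℓ ⬝ᵥ μ = ν ℓ := fun ℓ => by rw [hν]; rfl
  have hσe : ∀ ℓ, (V * Sp * Vᵀ) ℓ ℓ = V ℓ ⬝ᵥ Sp.mulVec (V ℓ) := by
    intro ℓ
    rw [Matrix.mul_assoc, Matrix.mul_apply_eq_vecMul, ← Matrix.mulVec_transpose]
    simp only [Matrix.mulVec, dotProduct, Matrix.mul_apply, Matrix.transpose_apply]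
    exact Finset.sum_congr rfl fun i _ => mul_comm _ _
  set g : Fin m → ℝ := fun ℓ => (1 - |ν ℓ|) ^ 2 / (2 * (V * Sp * Vᵀ) ℓ ℓ) with hg
  set I := ⨅ ℓ, g ℓ with hI
  have hIle : ∀ ℓ, I ≤ g ℓ := fun ℓ => ciInf_le (Finite.bddBelow_range g) ℓ
  obtain ⟨j, hj⟩ := exists_eq_ciInf_of_finite (f := g)
  have hσs : ∀ ℓ, ∀ s : ℝ, s ^ 2 = 1 → (s • V ℓ) ⬝ᵥ Sp.mulVec (s • V ℓ) = (V * Sp * Vᵀ) ℓ ℓ := by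
    intro ℓ s hs
    rw [Matrix.mulVec_smul, smul_dotProduct, dotProduct_smul, smul_eq_mul, smul_eq_mul, hσe,
      ← mul_assoc, ← sq, hs, one_mul]
  have hus : ∀ ℓ, ∀ s : ℝ, (s • V ℓ) ⬝ᵥ μ = s * ν ℓ := by
    intro ℓ s
    rw [smul_dotProduct, smul_eq_mul, hνe]
  have hsle : ∀ ℓ, ∀ s : ℝ, s ^ 2 = 1 → s * ν ℓ ≤ |ν ℓ| := by
    intro ℓ s hs
    rcases (mul_self_eq_one_iff.1 ((sq s).symm.trans hs)) with h | h <;> subst h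
    · simpa using le_abs_self _
    · simpa using neg_le_abs _
  -- upper bound for a half space
  have hupper : ∀ ε, 0 < ε → ∀ ℓ, ∀ s : ℝ, s ^ 2 = 1 →
      mvGaussian μ (ε • Sp) {x | 1 ≤ (s • V ℓ) ⬝ᵥ x} ≤
        ENNReal.ofReal (Real.exp (-I / ε) * ∫ z, stdDens Sp z) := by
    intro ε hε ℓ s hs
    have h1 := hsle ℓ s hs
    have h2 := hνlt ℓ
    refine le_trans (halfspace_upper hSp μ (s • V ℓ) (by rw [hσs ℓ s hs]; exact hσpos ℓ)
      (by rw [hus]; linarith) hε) (ENNReal.ofReal_le_ofReal ?_)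
    refine mul_le_mul_of_nonneg_right ?_ (stdDens_integral_pos hSp).le
    rw [Real.exp_le_exp, hσs ℓ s hs, hus]
    refine div_le_div_of_nonneg_right (neg_le_neg ((hIle ℓ).trans ?_)) hε.le
    have := hσpos ℓ
    refine div_le_div_of_nonneg_right ?_ (by positivity)
    refine pow_le_pow_left₀ (by linarith) (by linarith) 2
  obtain ⟨s, hs, hsν⟩ : ∃ s : ℝ, s ^ 2 = 1 ∧ s * ν j = |ν j| := by
    rcases abs_choice (ν j) with h | h
    · exact ⟨1, by norm_num, by rw [h]; ring⟩
    · exact ⟨-1, by norm_num, by rw [h]; ring⟩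
  obtain ⟨K, κ, hK, hlow⟩ := halfspace_lower hSp μ (s • V j)
    (by rw [hσs j s hs]; exact hσpos j) (by rw [hus, hsν]; exact hνlt j)
  have hIj : (1 - (s • V j) ⬝ᵥ μ) ^ 2 / (2 * ((s • V j) ⬝ᵥ Sp.mulVec (s • V j))) = I := by
    rw [hus, hsν, hσs j s hs, hI, ← hj]
  rw [hIj] at hlow
  have hKpos := stdDens_integral_pos hSp
  have hmpos : (0 : ℝ) < m := by exact_mod_cast hm
  have hup : ∀ ε, 0 < ε → mvGaussian μ (ε • Sp) {x | ∃ ℓ : Fin m, 1 ≤ |V.mulVec x ℓ|} ≤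
      ENNReal.ofReal (Real.exp (-I / ε) * (2 * m * ∫ z, stdDens Sp z)) := by
    intro ε hε
    have hsub : {x | ∃ ℓ : Fin m, 1 ≤ |V.mulVec x ℓ|} ⊆
        ⋃ ℓ : Fin m, ({x | 1 ≤ ((1 : ℝ) • V ℓ) ⬝ᵥ x} ∪ {x | 1 ≤ ((-1 : ℝ) • V ℓ) ⬝ᵥ x}) := by
      rintro x ⟨ℓ, hx⟩
      refine mem_iUnion.2 ⟨ℓ, ?_⟩
      have hx' : 1 ≤ |V ℓ ⬝ᵥ x| := hx
      rcases le_abs.1 hx' with h | h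
      · left; simpa using h
      · right; simpa using h
    refine (measure_mono hsub).trans ((measure_iUnion_fintype_le _ _).trans ?_)
    calc _ ≤ ∑ ℓ : Fin m, ENNReal.ofReal (2 * (Real.exp (-I / ε) * ∫ z, stdDens Sp z)) := by
          refine Finset.sum_le_sum fun ℓ _ => (measure_union_le _ _).trans ?_
          rw [two_mul, ENNReal.ofReal_add (by positivity) (by positivity)]
          exact add_le_add (hupper ε hε ℓ 1 (by norm_num)) (hupper ε hε ℓ (-1) (by norm_num))
      _ = _ := by
          rw [Finset.sum_const, Finset.card_univ, Fintype.card_fin, nsmul_eq_mul,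
            ← ENNReal.ofReal_natCast, ← ENNReal.ofReal_mul (by positivity)]
          congr 1; ring
  refine log_squeeze _ I κ K (2 * m * ∫ z, stdDens Sp z) hK (by positivity) ?_ ?_
  · intro ε hε
    have hne := ne_top_of_le_ne_top ENNReal.ofReal_ne_top (hup ε hε)
    rw [← ENNReal.ofReal_le_iff_le_toReal hne]
    refine (hlow ε hε).trans (measure_mono fun x hx => ⟨j, ?_⟩)
    have hx' : 1 ≤ s * (V j ⬝ᵥ x) := by simpa [smul_dotProduct] using hx
    change 1 ≤ |V j ⬝ᵥ x|
    have habs : |s| = 1 := by rwa [← sq_eq_sq₀ (abs_nonneg s) zero_le_one, sq_abs, one_pow]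
    calc (1 : ℝ) ≤ |s * (V j ⬝ᵥ x)| := hx'.trans (le_abs_self _)
      _ = _ := by rw [abs_mul, habs, one_mul]
  · intro ε hε
    exact ENNReal.toReal_le_of_le_ofReal (by positivity) (hup ε hε)
end

section
/- Let Σ_p ∈ ℝ^{n×n} be positive definite symmetric, V ∈ ℝ^{m×n}, μ ∈ ℝ^n, ν = Vμ with max_{k=1,…,m} |ν_k| < 1. Fix a line ℓ with ν_ℓ ≠ 0 and σ_ℓ² := (V Σ_p Vᵀ)_{ℓℓ} > 0, and let p^{(ℓ)} = μ + ((sign(ν_ℓ)−ν_ℓ)/σ_ℓ²) Σ_p Vᵀ e_ℓ. For ε > 0 let p_ε ~ N(μ, ε Σ_p) and f_ε = V p_ε. Then for every coordinate i ∈ {1,…,n} and every δ > 0, limsup_{ε→0⁺} ε·log [ ℙ(|(p_ε)_i − p^{(ℓ)}_i| ≥ δ and |(f_ε)_ℓ| ≥ 1) / ℙ(|(f_ε)_ℓ| ≥ 1) ] < 0; in particular the conditional probability ℙ(|(p_ε)_i − p^{(ℓ)}_i| ≥ δ ∣ |(f_ε)_ℓ| ≥ 1) tends to 0 as ε → 0.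 -/
open Matrix MeasureTheory Filter Topology Set

/-- quadratic form of the inverse covariance -/
noncomputable def QF {n : ℕ} (S : Matrix (Fin n) (Fin n) ℝ) (y : Fin n → ℝ) : ℝ :=
  y ⬝ᵥ (S⁻¹).mulVec y

lemma QF_nonneg {n : ℕ} {S : Matrix (Fin n) (Fin n) ℝ} (hS : S.PosDef) (y : Fin n → ℝ) :
    0 ≤ QF S y := by
  have := hS.inv.posSemidef.dotProduct_mulVec_nonneg y
  simpa [QF] using this

lemma QF_pos {n : ℕ} {S : Matrix (Fin n) (Fin n) ℝ} (hS : S.PosDef) (y : Fin n → ℝ)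
    (hy : y ≠ 0) : 0 < QF S y := by
  have := hS.inv.dotProduct_mulVec_pos hy
  simpa [QF] using this

lemma QF_cont {n : ℕ} (S : Matrix (Fin n) (Fin n) ℝ) : Continuous (QF S) := by
  unfold QF
  fun_prop

lemma QF_sub {n : ℕ} {S : Matrix (Fin n) (Fin n) ℝ} (hS : S.PosDef) (y v : Fin n → ℝ) (t : ℝ) :
    QF S (y - t • S.mulVec v) = QF S y - 2 * t * (v ⬝ᵥ y) + t ^ 2 * (v ⬝ᵥ S.mulVec v) := by
  have hdet : IsUnit S.det := hS.det_pos.ne'.isUnit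
  have h1 : (S⁻¹).mulVec (S.mulVec v) = v := by
    rw [Matrix.mulVec_mulVec, Matrix.nonsing_inv_mul _ hdet, Matrix.one_mulVec]
  have hsymm : Sᵀ = S := by
    have := hS.isHermitian
    rw [Matrix.IsHermitian, Matrix.conjTranspose_eq_transpose_of_trivial] at this
    exact this
  have h2 : (S.mulVec v) ⬝ᵥ (S⁻¹).mulVec y = v ⬝ᵥ y := by
    rw [Matrix.dotProduct_mulVec, ← Matrix.mulVec_transpose, Matrix.transpose_nonsing_inv, hsymm,
      h1]
  unfold QF
  rw [Matrix.mulVec_sub, Matrix.mulVec_smul, h1]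
  simp only [sub_dotProduct, dotProduct_sub, smul_dotProduct, dotProduct_smul, smul_eq_mul, h2]
  rw [dotProduct_comm y v, dotProduct_comm (S.mulVec v) v]
  ring

lemma QF_cs {n : ℕ} {S : Matrix (Fin n) (Fin n) ℝ} (hS : S.PosDef) (y v : Fin n → ℝ)
    (hv : 0 < v ⬝ᵥ S.mulVec v) :
    QF S y = (v ⬝ᵥ y) ^ 2 / (v ⬝ᵥ S.mulVec v)
      + QF S (y - ((v ⬝ᵥ y) / (v ⬝ᵥ S.mulVec v)) • S.mulVec v) := by
  rw [QF_sub hS]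
  field_simp
  ring

lemma QF_coord {n : ℕ} {S : Matrix (Fin n) (Fin n) ℝ} (hS : S.PosDef) :
    ∃ c : ℝ, 0 < c ∧ ∀ (y : Fin n → ℝ) (i : Fin n), c * y i ^ 2 ≤ QF S y := by
  have hpos : ∀ i, 0 < S i i := fun i => hS.diag_pos
  have hsum : ∀ i, S i i ≤ 1 + ∑ j, S j j := fun i => by
    have := Finset.single_le_sum (f := fun j => S j j) (fun j _ => (hpos j).le) (Finset.mem_univ i)
    linarith
  have hp : 0 < 1 + ∑ j, S j j := by
    have := Finset.sum_nonneg (s := Finset.univ) (f := fun j => S j j) (fun j _ => (hpos j).le)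
    linarith
  refine ⟨(1 + ∑ j, S j j)⁻¹, inv_pos.2 hp, fun y i => ?_⟩
  have hd : (Pi.single i 1 : Fin n → ℝ) ⬝ᵥ S.mulVec (Pi.single i 1) = S i i := by simp
  have h := QF_cs hS y (Pi.single i 1) (by rw [hd]; exact hpos i)
  have h2 := QF_nonneg hS (y - (((Pi.single i 1 : Fin n → ℝ) ⬝ᵥ y) /
    ((Pi.single i 1 : Fin n → ℝ) ⬝ᵥ S.mulVec (Pi.single i 1))) • S.mulVec (Pi.single i 1))
  rw [h]
  refine le_trans ?_ (le_add_of_nonneg_right h2)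
  rw [hd, single_dotProduct, one_mul, div_eq_inv_mul]
  exact mul_le_mul_of_nonneg_right (inv_anti₀ (hpos i) (hsum i)) (sq_nonneg _)

lemma QF_integrable {n : ℕ} (hn : 1 ≤ n) {S : Matrix (Fin n) (Fin n) ℝ} (hS : S.PosDef)
    (μ : Fin n → ℝ) :
    Integrable (fun x => Real.exp (-(1 / 2) * QF S (x - μ))) volume := by
  obtain ⟨c, hc, h⟩ := QF_coord hS
  have hn' : (0 : ℝ) < n := by exact_mod_cast hn
  have h0 : Integrable (fun x : Fin n → ℝ => ∏ i, Real.exp (-(c / (2 * n)) * (x i) ^ 2)) volume :=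
    Integrable.fintype_prod (f := fun (_ : Fin n) (t : ℝ) => Real.exp (-(c / (2 * n)) * t ^ 2))
      (fun i => integrable_exp_neg_mul_sq (by positivity))
  have h1 : Integrable (fun x : Fin n → ℝ => Real.exp (-(1 / 2) * QF S x)) volume := by
    refine h0.mono' ?_ (Eventually.of_forall fun x => ?_)
    · exact (Real.continuous_exp.comp (continuous_const.mul (QF_cont S))).aestronglyMeasurable
    · rw [Real.norm_eq_abs, abs_of_pos (Real.exp_pos _), ← Real.exp_sum, Real.exp_le_exp,
        ← Finset.mul_sum]
      have : ∑ i, c * x i ^ 2 ≤ ∑ _i : Fin n, QF S x := Finset.sum_le_sum fun i _ => h x i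
      rw [← Finset.mul_sum] at this
      simp only [Finset.sum_const, Finset.card_univ, Fintype.card_fin, nsmul_eq_mul] at this
      have e : c / (2 * n) * ∑ i, x i ^ 2 ≤ 1 / 2 * QF S x := by
        rw [div_mul_eq_mul_div, div_le_iff₀ (by positivity)]
        linarith
      linarith
  exact h1.comp_sub_right μ

lemma gauss_eq {n : ℕ} (hn : 1 ≤ n) {S : Matrix (Fin n) (Fin n) ℝ} (hS : S.PosDef)
    (μ : Fin n → ℝ) (ε : ℝ) (hε : 0 < ε) (hε1 : ε ≤ 1) :
    ∃ c : ℝ, 0 < c ∧ ∀ A : Set (Fin n → ℝ), MeasurableSet A →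
      (mvGaussian μ (ε • S) A).toReal
        = c * ∫ x in A, Real.exp (-(1 / 2) * QF S (x - μ))
            * Real.exp (-(1 / 2) * QF S (x - μ) * (1 / ε - 1)) := by
  have hdet : 0 < (ε • S).det := by
    rw [Matrix.det_smul]
    have := hS.det_pos
    positivity
  have hunit : IsUnit S.det := hS.det_pos.ne'.isUnit
  have hinv : (ε • S)⁻¹ = ε⁻¹ • S⁻¹ := by
    apply Matrix.inv_eq_left_inv
    rw [Matrix.smul_mul, Matrix.mul_smul, smul_smul, Matrix.nonsing_inv_mul _ hunit,
      inv_mul_cancel₀ hε.ne', one_smul]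
  refine ⟨(Real.sqrt ((2 * Real.pi) ^ n * (ε • S).det))⁻¹, ?_, fun A hA => ?_⟩
  · have := Real.pi_pos
    positivity
  · rw [mvGaussian, withDensity_apply _ hA, ← integral_const_mul, integral_eq_lintegral_of_nonneg_ae]
    · congr 1
      refine lintegral_congr fun x => ?_
      rw [hinv, ← Real.exp_add, Matrix.smul_mulVec, dotProduct_smul, smul_eq_mul]
      congr 3
      unfold QF
      field_simp
      ring
    · exact Eventually.of_forall fun x => by positivity
    · have := QF_cont S
      exact Continuous.aestronglyMeasurable (by fun_prop)

lemma int_aux {n : ℕ} (hn : 1 ≤ n) {S : Matrix (Fin n) (Fin n) ℝ} (hS : S.PosDef)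
    (μ : Fin n → ℝ) (T : ℝ) (hT : 0 ≤ T) :
    Integrable (fun x => Real.exp (-(1 / 2) * QF S (x - μ))
            * Real.exp (-(1 / 2) * QF S (x - μ) * T)) volume := by
  refine (QF_integrable hn hS μ).mono' ?_ (Eventually.of_forall fun x => ?_)
  · have := QF_cont S
    exact Continuous.aestronglyMeasurable (by fun_prop)
  · rw [Real.norm_eq_abs, abs_of_pos (by positivity)]
    refine mul_le_of_le_one_right (Real.exp_pos _).le ?_
    rw [Real.exp_le_one_iff]
    have := mul_nonneg (QF_nonneg hS (x - μ)) hT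
    linarith

lemma int_upper {n : ℕ} (hn : 1 ≤ n) {S : Matrix (Fin n) (Fin n) ℝ} (hS : S.PosDef)
    (μ : Fin n → ℝ) (A : Set (Fin n → ℝ)) (hA : MeasurableSet A) (a : ℝ)
    (ha : ∀ x ∈ A, a ≤ QF S (x - μ)) (T : ℝ) (hT : 0 ≤ T) :
    ∫ x in A, Real.exp (-(1 / 2) * QF S (x - μ)) * Real.exp (-(1 / 2) * QF S (x - μ) * T)
      ≤ (∫ x, Real.exp (-(1 / 2) * QF S (x - μ))) * Real.exp (-(1 / 2) * a * T) := by
  have hI := QF_integrable hn hS μ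
  calc _ ≤ ∫ x in A, Real.exp (-(1 / 2) * QF S (x - μ)) * Real.exp (-(1 / 2) * a * T) := by
        refine setIntegral_mono_on (int_aux hn hS μ T hT).integrableOn
          (hI.mul_const _).integrableOn hA fun x hx => ?_
        gcongr ?_ * Real.exp ?_
        have := mul_le_mul_of_nonneg_right (ha x hx) hT
        linarith
    _ = (∫ x in A, Real.exp (-(1 / 2) * QF S (x - μ))) * Real.exp (-(1 / 2) * a * T) :=
        integral_mul_const _ _
    _ ≤ _ := by
        refine mul_le_mul_of_nonneg_right ?_ (Real.exp_pos _).le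
        exact setIntegral_le_integral hI (Eventually.of_forall fun x => (Real.exp_pos _).le)

lemma int_lower {n : ℕ} (hn : 1 ≤ n) {S : Matrix (Fin n) (Fin n) ℝ} (hS : S.PosDef)
    (μ : Fin n → ℝ) (A U : Set (Fin n → ℝ)) (hA : MeasurableSet A) (hU : IsOpen U)
    (hUA : U ⊆ A) (M : ℝ) (hne : ∃ x ∈ U, QF S (x - μ) < M) :
    ∃ C : ℝ, 0 < C ∧ ∀ T : ℝ, 0 ≤ T → C * Real.exp (-(1 / 2) * M * T) ≤
      ∫ x in A, Real.exp (-(1 / 2) * QF S (x - μ)) * Real.exp (-(1 / 2) * QF S (x - μ) * T) := by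
  have hI := QF_integrable hn hS μ
  have hc := QF_cont S
  set W : Set (Fin n → ℝ) := U ∩ {x | QF S (x - μ) < M} with hW
  have hWo : IsOpen W := hU.inter (isOpen_lt (by fun_prop) continuous_const)
  have hWne : W.Nonempty := by
    obtain ⟨x, hx, hx'⟩ := hne
    exact ⟨x, hx, hx'⟩
  refine ⟨∫ x in W, Real.exp (-(1 / 2) * QF S (x - μ)), ?_, fun T hT => ?_⟩
  · rw [setIntegral_pos_iff_support_of_nonneg_ae (Eventually.of_forall fun x => (Real.exp_pos _).le)
      hI.integrableOn]
    have : Function.support (fun x => Real.exp (-(1 / 2) * QF S (x - μ))) = univ := by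
      ext x
      simp [Real.exp_ne_zero]
    rw [this, univ_inter]
    exact hWo.measure_pos volume hWne
  · rw [← integral_mul_const]
    calc _ ≤ ∫ x in W, Real.exp (-(1 / 2) * QF S (x - μ))
              * Real.exp (-(1 / 2) * QF S (x - μ) * T) := by
          refine setIntegral_mono_on (hI.mul_const _).integrableOn
            (int_aux hn hS μ T hT).integrableOn hWo.measurableSet fun x hx => ?_
          gcongr ?_ * Real.exp ?_
          have := mul_le_mul_of_nonneg_right (le_of_lt hx.2) hT
          linarith
      _ ≤ _ := by
          refine setIntegral_mono_set (int_aux hn hS μ T hT).integrableOn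
            (Eventually.of_forall fun x => by positivity) ?_
          exact (inter_subset_left.trans hUA).eventuallyLE

/-- conclusion from two-sided exponential bounds -/
lemma final_aux (R : ℝ → ℝ) (C₁ C₂ M d : ℝ) (h1 : 0 < C₁) (h2 : 0 < C₂) (hd : 0 < d)
    (hlo : ∀ ε, 0 < ε → ε ≤ 1 → C₁ * Real.exp (-M * (1 / ε - 1)) ≤ R ε)
    (hup : ∀ ε, 0 < ε → ε ≤ 1 → R ε ≤ C₂ * Real.exp (-d * (1 / ε - 1))) :
    limsup (fun ε => ε * Real.log (R ε)) (𝓝[>] (0 : ℝ)) < 0 ∧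
      Tendsto R (𝓝[>] (0 : ℝ)) (𝓝 0) := by
  have hev : ∀ᶠ ε in 𝓝[>] (0 : ℝ), 0 < ε ∧ ε ≤ 1 := by
    filter_upwards [Ioc_mem_nhdsGT (show (0 : ℝ) < 1 by norm_num)] with ε hε using hε
  have hlim : ∀ C K : ℝ, Tendsto (fun ε : ℝ => ε * Real.log C - K * (1 - ε)) (𝓝[>] (0 : ℝ))
      (𝓝 (-K)) := fun C K => by
    have : Continuous (fun ε : ℝ => ε * Real.log C - K * (1 - ε)) := by fun_prop
    have h := this.tendsto 0
    simp only [zero_mul, sub_zero, mul_one, zero_sub] at h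
    exact h.mono_left nhdsWithin_le_nhds
  have hlog : ∀ C K ε : ℝ, 0 < C → 0 < ε →
      ε * Real.log (C * Real.exp (-K * (1 / ε - 1))) = ε * Real.log C - K * (1 - ε) := by
    intro C K ε hC hε
    rw [Real.log_mul hC.ne' (Real.exp_pos _).ne', Real.log_exp]
    field_simp
    ring
  constructor
  · have hle : limsup (fun ε => ε * Real.log (R ε)) (𝓝[>] (0 : ℝ)) ≤ -d / 2 := by
      refine limsup_le_of_le ?_ ?_
      · refine IsBoundedUnder.isCoboundedUnder_le (l := 𝓝[>] (0 : ℝ)) ?_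
        refine ⟨-M - 1, ?_⟩
        rw [eventually_map]
        filter_upwards [hev, (hlim C₁ M).eventually (lt_mem_nhds (show -M - 1 < -M by linarith))]
          with ε hε h
        rw [← hlog C₁ M ε h1 hε.1] at h
        refine h.le.trans ?_
        have := hε.1
        gcongr
        exact hlo ε hε.1 hε.2
      · filter_upwards [hev, (hlim C₂ d).eventually (gt_mem_nhds (show -d < -d / 2 by linarith))]
          with ε hε h
        rw [← hlog C₂ d ε h2 hε.1] at h
        refine le_trans ?_ h.le
        have h3 := hε.1
        have h4 : 0 < R ε := lt_of_lt_of_le (by positivity) (hlo ε hε.1 hε.2)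
        gcongr
        exact hup ε hε.1 hε.2
    linarith
  · have ht : Tendsto (fun ε : ℝ => C₂ * Real.exp (-d * (1 / ε - 1))) (𝓝[>] (0 : ℝ)) (𝓝 0) := by
      have hb : Tendsto (fun ε : ℝ => d * (1 / ε - 1)) (𝓝[>] (0 : ℝ)) atTop := by
        refine Tendsto.const_mul_atTop hd ?_
        simp only [one_div, sub_eq_add_neg]
        exact tendsto_atTop_add_const_right _ _ tendsto_inv_nhdsGT_zero
      have := (Real.tendsto_exp_neg_atTop_nhds_zero.comp hb).const_mul C₂
      simpa [Function.comp_def, neg_mul] using this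
    refine tendsto_of_tendsto_of_tendsto_of_le_of_le' tendsto_const_nhds ht ?_ ?_
    · filter_upwards [hev] with ε hε
      exact le_trans (by positivity) (hlo ε hε.1 hε.2)
    · filter_upwards [hev] with ε hε using hup ε hε.1 hε.2

/-- a closed set on which the form exceeds `b` pointwise has a uniform gap -/
lemma gap_aux {n : ℕ} {S : Matrix (Fin n) (Fin n) ℝ} (hS : S.PosDef)
    (μ : Fin n → ℝ) (A : Set (Fin n → ℝ)) (hA : IsClosed A) (b : ℝ)
    (hb : ∀ x ∈ A, b < QF S (x - μ)) : ∃ a, b < a ∧ ∀ x ∈ A, a ≤ QF S (x - μ) := by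
  have hc := QF_cont S
  have hcont : Continuous fun x => QF S (x - μ) := by fun_prop
  obtain ⟨c, hc0, hcoord⟩ := QF_coord hS
  set B := A ∩ {x | QF S (x - μ) ≤ b + 1} with hB
  have hBc : IsClosed B := hA.inter (isClosed_le hcont continuous_const)
  have hBb : B ⊆ Metric.closedBall μ (Real.sqrt (|b + 1| / c)) := by
    rintro x ⟨_, hx⟩
    rw [Metric.mem_closedBall, dist_pi_le_iff (Real.sqrt_nonneg _)]
    intro j
    rw [Real.dist_eq]
    apply Real.abs_le_sqrt
    rw [le_div_iff₀ hc0]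
    have h1 := hcoord (x - μ) j
    have h2 : QF S (x - μ) ≤ b + 1 := hx
    have h3 := le_abs_self (b + 1)
    simp only [Pi.sub_apply] at h1
    linarith
  have hBk : IsCompact B := (isCompact_closedBall μ _).of_isClosed_subset hBc hBb
  rcases B.eq_empty_or_nonempty with he | hne
  · refine ⟨b + 1, by linarith, fun x hx => ?_⟩
    by_contra hlt
    have : x ∈ B := ⟨hx, (not_le.1 hlt).le⟩
    rw [he] at this
    exact this
  · obtain ⟨x0, hx0, hmin⟩ := hBk.exists_isMinOn hne hcont.continuousOn
    refine ⟨QF S (x0 - μ), hb x0 hx0.1, fun x hx => ?_⟩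
    by_cases h : QF S (x - μ) ≤ b + 1
    · exact hmin ⟨hx, h⟩
    · exact le_trans hx0.2 (not_le.1 h).le

/-- Proposition 2: conditionally on the failure of line `ℓ`, the power injections concentrate
around the most likely configuration `p^{(ℓ)} = μ + ((sign(ν_ℓ)−ν_ℓ)/σ_ℓ²) Σ_p Vᵀ e_ℓ`:
for every coordinate `i` and every `δ > 0`, the conditional probability of
`|(p_ε)_i − p^{(ℓ)}_i| ≥ δ` decays exponentially (negative limsup of `ε · log`), and
in particular tends to `0` as `ε → 0⁺`. -/
theorem conditional_concentration_injections (n m : ℕ) (hn : 1 ≤ n) (hm : 1 ≤ m)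
    (Sp : Matrix (Fin n) (Fin n) ℝ) (hSp : Sp.PosDef)
    (V : Matrix (Fin m) (Fin n) ℝ) (μ : Fin n → ℝ)
    (ν : Fin m → ℝ) (hν : ν = V.mulVec μ)
    (hνlt : ∀ k : Fin m, |ν k| < 1)
    (ℓ : Fin m) (hℓ0 : ν ℓ ≠ 0)
    (σsq : ℝ) (hσdef : σsq = (V * Sp * Vᵀ) ℓ ℓ) (hσpos : 0 < σsq)
    (pstar : Fin n → ℝ)
    (hpstar : pstar = μ + ((sgn (ν ℓ) - ν ℓ) / σsq) • Sp.mulVec (Vᵀ.mulVec (Pi.single ℓ 1)))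
    (i : Fin n) (δ : ℝ) (hδ : 0 < δ) :
    limsup (fun ε : ℝ =>
        ε * Real.log
          ((mvGaussian μ (ε • Sp) ({x | δ ≤ |x i - pstar i|} ∩ {x | 1 ≤ |V.mulVec x ℓ|})).toReal /
            (mvGaussian μ (ε • Sp) {x | 1 ≤ |V.mulVec x ℓ|}).toReal))
      (𝓝[>] (0 : ℝ)) < 0 ∧
    Tendsto (fun ε : ℝ =>
        (mvGaussian μ (ε • Sp) ({x | δ ≤ |x i - pstar i|} ∩ {x | 1 ≤ |V.mulVec x ℓ|})).toReal /
          (mvGaussian μ (ε • Sp) {x | 1 ≤ |V.mulVec x ℓ|}).toReal)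
      (𝓝[>] (0 : ℝ)) (𝓝 0) := by
  set v : Fin n → ℝ := V ℓ with hv
  have hvt : Vᵀ.mulVec (Pi.single ℓ 1) = v := by
    ext j
    simp [hv]
  rw [hvt] at hpstar
  have hVx : ∀ x : Fin n → ℝ, V.mulVec x ℓ = v ⬝ᵥ x := fun x => rfl
  have hσ : σsq = v ⬝ᵥ Sp.mulVec v := by
    rw [hσdef, Matrix.mul_assoc, Matrix.mul_apply_eq_vecMul]
    simp only [hv, Matrix.mulVec, dotProduct, Matrix.vecMul, Matrix.mul_apply, Matrix.transpose_apply]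
  have hνv : ν ℓ = v ⬝ᵥ μ := by rw [hν]; rfl
  have hνl := abs_lt.1 (hνlt ℓ)
  set g : ℝ := sgn (ν ℓ) - ν ℓ with hg
  have hsg : ∀ f : ℝ, 1 ≤ |f| → g ^ 2 ≤ (f - ν ℓ) ^ 2 ∧ ((f - ν ℓ) ^ 2 = g ^ 2 → f - ν ℓ = g) := by
    intro f hf
    have hf' := le_abs.1 hf
    rw [hg]
    unfold sgn
    split_ifs with h0
    · have h0' : 0 < ν ℓ := lt_of_le_of_ne h0 (Ne.symm hℓ0)
      rcases hf' with h | h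
      · exact ⟨by nlinarith, fun e => by nlinarith⟩
      · exact ⟨by nlinarith, fun e => by nlinarith⟩
    · have h0' : ν ℓ < 0 := not_le.1 h0
      rcases hf' with h | h
      · exact ⟨by nlinarith, fun e => by nlinarith⟩
      · exact ⟨by nlinarith, fun e => by nlinarith⟩
  have hs1 : |sgn (ν ℓ)| = 1 := by
    unfold sgn
    split_ifs <;> simp
  set A : Set (Fin n → ℝ) := {x | δ ≤ |x i - pstar i|} ∩ {x | 1 ≤ |V.mulVec x ℓ|} with hA
  set B : Set (Fin n → ℝ) := {x | 1 ≤ |V.mulVec x ℓ|} with hB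
  have hVc : Continuous fun x : Fin n → ℝ => V.mulVec x ℓ := by
    simp only [hVx]
    fun_prop
  have hBcl : IsClosed B := isClosed_le continuous_const hVc.abs
  have hAcl : IsClosed A := (isClosed_le continuous_const (by fun_prop)).inter hBcl
  have hgap : ∀ x ∈ A, g ^ 2 / σsq < QF Sp (x - μ) := by
    rintro x ⟨hx1, hx2⟩
    have hx1 : δ ≤ |x i - pstar i| := hx1
    have hx2 : 1 ≤ |V.mulVec x ℓ| := hx2
    have hdec := QF_cs hSp (x - μ) v (hσ ▸ hσpos)
    rw [← hσ] at hdec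
    have hvy : v ⬝ᵥ (x - μ) = V.mulVec x ℓ - ν ℓ := by rw [dotProduct_sub, hνv, hVx]
    rw [hvy] at hdec
    obtain ⟨h1, h2⟩ := hsg _ hx2
    have h3 := div_le_div_of_nonneg_right h1 hσpos.le
    have h4 := QF_nonneg hSp (x - μ - ((V.mulVec x ℓ - ν ℓ) / σsq) • Sp.mulVec v)
    by_contra hcon
    have hcon := not_lt.1 hcon
    have h5 : (V.mulVec x ℓ - ν ℓ) ^ 2 / σsq = g ^ 2 / σsq := by linarith
    have h6 : (V.mulVec x ℓ - ν ℓ) ^ 2 = g ^ 2 := by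
      field_simp at h5
      exact h5
    have h7 := h2 h6
    have h8 : x - μ - ((V.mulVec x ℓ - ν ℓ) / σsq) • Sp.mulVec v = 0 := by
      by_contra hne
      have := QF_pos hSp _ hne
      linarith
    rw [h7] at h8
    have h9 : x = pstar := by
      rw [hpstar]
      have := sub_eq_zero.1 h8
      rw [← this]
      abel
    rw [h9, sub_self, abs_zero] at hx1
    linarith
  obtain ⟨a, hba, hQa⟩ := gap_aux hSp μ A hAcl _ hgap
  have hupA := fun T hT => int_upper hn hSp μ A hAcl.measurableSet a hQa T hT
  have hupB := fun T hT => int_upper hn hSp μ B hBcl.measurableSet 0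
    (fun x _ => QF_nonneg hSp (x - μ)) T hT
  set K := ∫ x, Real.exp (-(1 / 2) * QF Sp (x - μ)) with hK
  set b' : ℝ := (g ^ 2 / σsq + a) / 2 with hb'
  have hgpos : sgn (ν ℓ) * g > 0 := by
    rw [hg]
    unfold sgn
    split_ifs <;> linarith
  have hlineQ : ∀ t : ℝ, QF Sp (t • Sp.mulVec v) = t ^ 2 * σsq := by
    intro t
    have := QF_sub hSp 0 v (-t)
    simpa [QF, ← hσ] using this
  have hden : ∃ x ∈ {x : Fin n → ℝ | 1 < |V.mulVec x ℓ|}, QF Sp (x - μ) < b' := by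
    have hcont : Continuous fun τ : ℝ => (τ * g / σsq) ^ 2 * σsq := by fun_prop
    have hlt : (1 * g / σsq) ^ 2 * σsq < b' := by
      have : (1 * g / σsq) ^ 2 * σsq = g ^ 2 / σsq := by field_simp
      rw [this, hb']
      linarith
    have hev : ∀ᶠ τ in 𝓝[>] (1 : ℝ), (τ * g / σsq) ^ 2 * σsq < b' ∧ 1 < τ :=
      ((((hcont.tendsto 1).eventually (gt_mem_nhds hlt)).filter_mono nhdsWithin_le_nhds).and
        self_mem_nhdsWithin)
    obtain ⟨τ, hτ1, hτ2⟩ := hev.exists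
    refine ⟨μ + (τ * g / σsq) • Sp.mulVec v, ?_, ?_⟩
    · have : V.mulVec (μ + (τ * g / σsq) • Sp.mulVec v) ℓ = sgn (ν ℓ) + (τ - 1) * g := by
        rw [hVx, dotProduct_add, dotProduct_smul, ← hσ, ← hνv, smul_eq_mul,
          div_mul_cancel₀ _ hσpos.ne']
        linear_combination hg
      rw [mem_ofPred_eq, this]
      have h2 : 0 < (τ - 1) * (sgn (ν ℓ) * g) := mul_pos (by linarith) hgpos
      rw [lt_abs]
      unfold sgn at h2 ⊢
      split_ifs at h2 ⊢
      · left; nlinarith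
      · right; nlinarith
    · rw [add_sub_cancel_left, hlineQ]
      exact hτ1
  obtain ⟨C3, hC3, hloB⟩ := int_lower hn hSp μ B {x | 1 < |V.mulVec x ℓ|} hBcl.measurableSet
    (isOpen_lt continuous_const hVc.abs)
    (fun x hx => le_of_lt (show 1 < |V.mulVec x ℓ| from hx)) b' hden
  have hnum : ∃ x : Fin n → ℝ, x ∈ {x : Fin n → ℝ | δ < |x i - pstar i|} ∩ {x | 1 < |V.mulVec x ℓ|} := by
    have hz : ∃ z : Fin n → ℝ, z i ≠ 0 ∧ v ⬝ᵥ z ≠ 0 := by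
      by_cases hu : Sp.mulVec v i = 0
      · by_cases hvi : 0 ≤ v i
        · refine ⟨Sp.mulVec v + Pi.single i 1, by simp [hu], ?_⟩
          rw [dotProduct_add, ← hσ, dotProduct_single, mul_one]
          linarith
        · refine ⟨Sp.mulVec v - Pi.single i 1, by simp [hu], ?_⟩
          rw [dotProduct_sub, ← hσ, dotProduct_single, mul_one]
          linarith
      · exact ⟨Sp.mulVec v, hu, by rw [← hσ]; exact hσpos.ne'⟩
    obtain ⟨z, hz1, hz2⟩ := hz
    have p1 := abs_pos.2 hz1
    have p2 := abs_pos.2 hz2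
    set w := |v ⬝ᵥ pstar| with hw
    have hw0 : 0 ≤ w := abs_nonneg _
    set r : ℝ := δ / |z i| + (1 + w) / |v ⬝ᵥ z| + 1 with hr
    have q1 : 0 ≤ δ / |z i| := by positivity
    have q2 : 0 ≤ (1 + w) / |v ⬝ᵥ z| := by positivity
    have hr0 : 0 < r := by rw [hr]; linarith
    refine ⟨pstar + r • z, ?_, ?_⟩
    · simp only [mem_ofPred_eq, Pi.add_apply, Pi.smul_apply, smul_eq_mul, add_sub_cancel_left, abs_mul,
        abs_of_pos hr0]
      rw [← div_lt_iff₀ p1]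
      linarith
    · rw [mem_ofPred_eq, hVx, dotProduct_add, dotProduct_smul, smul_eq_mul]
      have h1 : 1 + w < r * |v ⬝ᵥ z| := by
        rw [← div_lt_iff₀ p2]
        linarith
      have h2 : |r * (v ⬝ᵥ z)| = r * |v ⬝ᵥ z| := by rw [abs_mul, abs_of_pos hr0]
      have h3 := abs_sub_abs_le_abs_sub (r * (v ⬝ᵥ z)) (-(v ⬝ᵥ pstar))
      rw [abs_neg, h2, sub_neg_eq_add, add_comm (r * (v ⬝ᵥ z))] at h3
      linarith
  obtain ⟨x1, hx1⟩ := hnum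
  obtain ⟨C4, hC4, hloA⟩ := int_lower hn hSp μ A
    ({x : Fin n → ℝ | δ < |x i - pstar i|} ∩ {x | 1 < |V.mulVec x ℓ|}) hAcl.measurableSet
    ((isOpen_lt continuous_const (by fun_prop)).inter (isOpen_lt continuous_const hVc.abs))
    (fun x hx => ⟨le_of_lt (show δ < |x i - pstar i| from hx.1),
      le_of_lt (show 1 < |V.mulVec x ℓ| from hx.2)⟩) (QF Sp (x1 - μ) + 1)
    ⟨x1, hx1, by linarith⟩
  set M := QF Sp (x1 - μ) + 1 with hM
  have hKpos : 0 < K := by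
    have h1 := hloB 0 le_rfl
    have h2 := hupB 0 le_rfl
    simp only [mul_zero, Real.exp_zero, mul_one] at h1 h2
    linarith
  refine final_aux _ (C4 / K) (K / C3) (M / 2) ((a - b') / 2) (by positivity) (by positivity)
    (by rw [hb']; linarith) ?_ ?_
  · intro ε hε hε1
    obtain ⟨c, hc, hG⟩ := gauss_eq hn hSp μ ε hε hε1
    have hT : 0 ≤ 1 / ε - 1 := by
      rw [sub_nonneg, le_div_iff₀ hε]
      linarith
    rw [hG A hAcl.measurableSet, hG B hBcl.measurableSet, mul_div_mul_left _ _ hc.ne']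
    have h1 := hloA _ hT
    have h2 := hupB _ hT
    have h3 := hloB _ hT
    simp only [mul_zero, zero_mul, Real.exp_zero, mul_one] at h2
    rw [div_mul_eq_mul_div]
    refine div_le_div₀ (le_trans (by positivity) h1) ?_ (lt_of_lt_of_le (by positivity) h3) h2
    rw [show -(M / 2) * (1 / ε - 1) = -(1 / 2) * M * (1 / ε - 1) by ring]
    exact h1
  · intro ε hε hε1
    obtain ⟨c, hc, hG⟩ := gauss_eq hn hSp μ ε hε hε1
    have hT : 0 ≤ 1 / ε - 1 := by
      rw [sub_nonneg, le_div_iff₀ hε]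
      linarith
    rw [hG A hAcl.measurableSet, hG B hBcl.measurableSet, mul_div_mul_left _ _ hc.ne']
    have h1 := hupA _ hT
    have h3 := hloB _ hT
    refine (div_le_div₀ (by positivity) h1 (by positivity) h3).trans (le_of_eq ?_)
    rw [mul_div_mul_comm, ← Real.exp_sub]
    congr 2
    ring
end

section
/- Let Σ_p ∈ ℝ^{n×n} be positive definite symmetric, V ∈ ℝ^{m×n}, μ ∈ ℝ^n, ν = Vμ. Fix a line ℓ with |ν_ℓ| < 1, ν_ℓ ≠ 0 and σ_ℓ² := (V Σ_p Vᵀ)_{ℓℓ} > 0, let g(p) = ½ (p−μ)ᵀ Σ_p⁻¹ (p−μ), and let p^{(ℓ)} = μ + ((sign(ν_ℓ)−ν_ℓ)/σ_ℓ²) Σ_p Vᵀ e_ℓ. Then for every coordinate i ∈ {1,…,n} and every δ > 0, the infimum of g over {p ∈ ℝ^n : |(Vp)_ℓ| ≥ 1 and |p_i − p^{(ℓ)}_i| ≥ δ} is strictly greater than the infimum of g over {p ∈ ℝ^n : |(Vp)_ℓ| ≥ 1}. -/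
open Matrix

theorem aux_cs {n : ℕ} (S : Matrix (Fin n) (Fin n) ℝ) (hS : S.PosDef) (d w : Fin n → ℝ)
    (hC : 0 < w ⬝ᵥ S *ᵥ w) :
    (d ⬝ᵥ w) ^ 2 ≤ (d ⬝ᵥ S⁻¹ *ᵥ d) * (w ⬝ᵥ S *ᵥ w) := by
  have hdet : IsUnit S.det := (Matrix.isUnit_iff_isUnit_det S).1 hS.isUnit
  have hsym : Sᵀ = S := by
    have := hS.isHermitian.eq
    simpa [Matrix.conjTranspose_eq_transpose_of_trivial] using this
  have hisym : S⁻¹ᵀ = S⁻¹ := by rw [Matrix.transpose_nonsing_inv, hsym]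
  have h1 : S⁻¹ *ᵥ (S *ᵥ w) = w := by
    rw [Matrix.mulVec_mulVec, Matrix.nonsing_inv_mul _ hdet, Matrix.one_mulVec]
  have h2 : (S *ᵥ w) ⬝ᵥ S⁻¹ *ᵥ d = d ⬝ᵥ w := by
    rw [Matrix.dotProduct_mulVec, ← Matrix.mulVec_transpose, hisym, h1, dotProduct_comm]
  have h0 := hS.inv.posSemidef.dotProduct_mulVec_nonneg
    ((w ⬝ᵥ S *ᵥ w) • d - (d ⬝ᵥ w) • (S *ᵥ w))
  simp only [star_trivial, Matrix.mulVec_sub, Matrix.mulVec_smul, h1, sub_dotProduct,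
    dotProduct_sub, smul_dotProduct, dotProduct_smul, h2, smul_eq_mul,
    dotProduct_comm (S *ᵥ w) w] at h0
  by_contra hlt
  push Not at hlt
  nlinarith [mul_pos hC (sub_pos.2 hlt)]

theorem aux_exp {n : ℕ} (S : Matrix (Fin n) (Fin n) ℝ) (hS : S.PosDef) (h w : Fin n → ℝ)
    (t : ℝ) :
    (t • (S *ᵥ w) + h) ⬝ᵥ S⁻¹ *ᵥ (t • (S *ᵥ w) + h) =
      t ^ 2 * (w ⬝ᵥ S *ᵥ w) + 2 * t * (h ⬝ᵥ w) + h ⬝ᵥ S⁻¹ *ᵥ h := by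
  have hdet : IsUnit S.det := (Matrix.isUnit_iff_isUnit_det S).1 hS.isUnit
  have hsym : Sᵀ = S := by
    have := hS.isHermitian.eq
    simpa [Matrix.conjTranspose_eq_transpose_of_trivial] using this
  have hisym : S⁻¹ᵀ = S⁻¹ := by rw [Matrix.transpose_nonsing_inv, hsym]
  have h1 : S⁻¹ *ᵥ (S *ᵥ w) = w := by
    rw [Matrix.mulVec_mulVec, Matrix.nonsing_inv_mul _ hdet, Matrix.one_mulVec]
  have h2 : (S *ᵥ w) ⬝ᵥ S⁻¹ *ᵥ h = h ⬝ᵥ w := by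
    rw [Matrix.dotProduct_mulVec, ← Matrix.mulVec_transpose, hisym, h1, dotProduct_comm]
  simp only [Matrix.mulVec_add, Matrix.mulVec_smul, h1, add_dotProduct,
    dotProduct_add, smul_dotProduct, dotProduct_smul, h2, smul_eq_mul,
    dotProduct_comm (S *ᵥ w) w]
  ring

/-- Key step in the proof of Proposition 2 (`J_ℓ > I_ℓ`): the infimum of the Gaussian rate
function `g` over `{p : |(Vp)_ℓ| ≥ 1}` is strictly smaller than its infimum over the subset
where in addition `|p_i − p^{(ℓ)}_i| ≥ δ`. -/
theorem strict_gap_rate_infima (n m : ℕ) (hn : 1 ≤ n) (hm : 1 ≤ m)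
    (Sp : Matrix (Fin n) (Fin n) ℝ) (hSp : Sp.PosDef)
    (V : Matrix (Fin m) (Fin n) ℝ) (μ : Fin n → ℝ)
    (ν : Fin m → ℝ) (hν : ν = V.mulVec μ)
    (ℓ : Fin m) (hℓ : |ν ℓ| < 1) (hℓ0 : ν ℓ ≠ 0)
    (σsq : ℝ) (hσdef : σsq = (V * Sp * Vᵀ) ℓ ℓ) (hσpos : 0 < σsq)
    (g : (Fin n → ℝ) → ℝ)
    (hg : ∀ p, g p = (1 / 2) * ((p - μ) ⬝ᵥ (Sp⁻¹).mulVec (p - μ)))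
    (pstar : Fin n → ℝ)
    (hpstar : pstar = μ + ((sgn (ν ℓ) - ν ℓ) / σsq) • Sp.mulVec (Vᵀ.mulVec (Pi.single ℓ 1)))
    (i : Fin n) (δ : ℝ) (hδ : 0 < δ) :
    sInf (g '' {p | 1 ≤ |V.mulVec p ℓ|}) <
      sInf (g '' {p | 1 ≤ |V.mulVec p ℓ| ∧ δ ≤ |p i - pstar i|}) := by
  have hw : Vᵀ.mulVec (Pi.single ℓ 1) = V ℓ := by
    ext j; simp
  rw [hw] at hpstar
  set w : Fin n → ℝ := V ℓ with hwdef
  have hV : ∀ p, V.mulVec p ℓ = p ⬝ᵥ w := fun p => by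
    rw [dotProduct_comm]; rfl
  have hσ : w ⬝ᵥ Sp *ᵥ w = σsq := by
    rw [hσdef, Matrix.mul_assoc, Matrix.mul_apply]
    rfl
  have hνw : ν ℓ = μ ⬝ᵥ w := by rw [hν, hV]
  simp only [hV]
  clear hν hw hσdef hV
  set a := ν ℓ with ha
  have hs : (0 < a ∧ sgn a = 1) ∨ (a < 0 ∧ sgn a = -1) := by
    rcases lt_or_gt_of_ne hℓ0 with h | h
    · right; exact ⟨h, if_neg (not_le.2 h)⟩
    · left; exact ⟨h, if_pos h.le⟩
  set s := sgn a with hsdef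
  obtain ⟨hl1, hl2⟩ := abs_lt.1 hℓ
  have hSii : 0 < (Pi.single i 1 : Fin n → ℝ) ⬝ᵥ Sp *ᵥ (Pi.single i 1) := by
    have := hSp.diag_pos (i := i)
    simpa using this
  set e : Fin n → ℝ := Pi.single i 1 with he
  have hde : ∀ h : Fin n → ℝ, h ⬝ᵥ e = h i := fun h => by simp [he]
  set C := e ⬝ᵥ Sp *ᵥ e with hC
  have hQ0 : ∀ h : Fin n → ℝ, 0 ≤ h ⬝ᵥ Sp⁻¹ *ᵥ h := fun h => by
    simpa using hSp.inv.posSemidef.dotProduct_mulVec_nonneg h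
  have hg0 : ∀ p, 0 ≤ g p := fun p => by
    rw [hg]; exact mul_nonneg (by norm_num) (hQ0 _)
  have huw : (Sp *ᵥ w) ⬝ᵥ w = σsq := by rw [dotProduct_comm, hσ]
  have hpsw : pstar ⬝ᵥ w = s := by
    rw [hpstar, add_dotProduct, smul_dotProduct, huw, ← hνw, smul_eq_mul]
    field_simp; ring
  have hgps : g pstar = (s - a) ^ 2 / (2 * σsq) := by
    have := aux_exp Sp hSp 0 w ((s - a) / σsq)
    rw [hg, hpstar, add_sub_cancel_left]
    rw [add_zero] at this
    rw [this, hσ]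
    simp
    field_simp
  have h1 : sInf (g '' {p | 1 ≤ |p ⬝ᵥ w|}) ≤ g pstar := by
    apply csInf_le
    · exact ⟨0, by rintro _ ⟨p, _, rfl⟩; exact hg0 p⟩
    · refine ⟨pstar, ?_, rfl⟩
      show 1 ≤ |pstar ⬝ᵥ w|
      rw [hpsw]
      rcases hs with ⟨_, h⟩ | ⟨_, h⟩ <;> rw [h] <;> simp
  have hε : 0 < min (2 * |a| / σsq) (δ ^ 2 / (2 * C)) := by
    have := abs_pos.2 hℓ0
    apply lt_min <;> positivity
  refine lt_of_le_of_lt h1 (lt_of_lt_of_le (lt_add_of_pos_right _ hε) ?_)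
  apply le_csInf
  · -- nonemptiness
    obtain ⟨v, hv1, hv2⟩ : ∃ v : Fin n → ℝ, v ⬝ᵥ w ≠ 0 ∧ v i ≠ 0 := by
      by_cases hu : (Sp *ᵥ w) i = 0
      · by_cases h : σsq + w i = 0
        · refine ⟨Sp *ᵥ w - e, ?_, ?_⟩
          · rw [sub_dotProduct, huw, dotProduct_comm, hde]
            intro h'; linarith
          · simp [hu, he]
        · refine ⟨Sp *ᵥ w + e, ?_, ?_⟩
          · rw [add_dotProduct, huw, dotProduct_comm, hde]
            exact h
          · simp [hu, he]
      · exact ⟨_, by rw [huw]; exact hσpos.ne', hu⟩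
    refine Set.Nonempty.image _ ⟨(1 / |v ⬝ᵥ w| + (δ + |pstar i|) / |v i|) • v, ?_, ?_⟩
    · have hp := abs_pos.2 hv1
      have hp2 := abs_pos.2 hv2
      rw [smul_dotProduct, smul_eq_mul, abs_mul, abs_of_nonneg (by positivity), add_mul,
        one_div, inv_mul_cancel₀ hp.ne']
      have : 0 ≤ (δ + |pstar i|) / |v i| * |v ⬝ᵥ w| := by positivity
      linarith
    · have hp := abs_pos.2 hv1
      have hp2 := abs_pos.2 hv2
      refine le_trans ?_ (abs_sub_abs_le_abs_sub _ _)
      rw [Pi.smul_apply, smul_eq_mul, abs_mul, abs_of_nonneg (by positivity), add_mul,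
        div_mul_cancel₀ _ hp2.ne']
      have : 0 ≤ 1 / |v ⬝ᵥ w| * |v i| := by positivity
      linarith
  · rintro _ ⟨p, ⟨hp1, hp2⟩, rfl⟩
    by_cases hsp : 1 ≤ s * (p ⬝ᵥ w)
    · refine le_trans (add_le_add_right (min_le_right _ _) _) ?_
      have hx := aux_exp Sp hSp (p - pstar) w ((s - a) / σsq)
      have hpe : ((s - a) / σsq) • Sp *ᵥ w + (p - pstar) = p - μ := by
        rw [hpstar]; abel
      rw [hpe, hσ, sub_dotProduct p pstar w, hpsw] at hx
      have hcs := aux_cs Sp hSp (p - pstar) e hSii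
      rw [hde, Pi.sub_apply, ← hC] at hcs
      have hd2 : δ ^ 2 ≤ (p i - pstar i) ^ 2 := by
        rw [← sq_abs (p i - pstar i)]; gcongr
      have hq : δ ^ 2 / C ≤ (p - pstar) ⬝ᵥ Sp⁻¹ *ᵥ (p - pstar) := by
        rw [div_le_iff₀ hSii]; linarith
      have hc : 0 ≤ (s - a) / σsq * (p ⬝ᵥ w - s) := by
        rw [div_mul_eq_mul_div]
        apply div_nonneg _ hσpos.le
        rcases hs with ⟨_, h⟩ | ⟨_, h⟩ <;> rw [h] at hsp ⊢ <;> nlinarith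
      rw [hgps, hg, hx]
      have e1 : (s - a) ^ 2 / (2 * σsq) = 1 / 2 * (((s - a) / σsq) ^ 2 * σsq) := by
        field_simp
      have e2 : δ ^ 2 / (2 * C) = 1 / 2 * (δ ^ 2 / C) := by
        field_simp
      rw [e1, e2]
      linarith
    · refine le_trans (add_le_add_right (min_le_left _ _) _) ?_
      have hcs := aux_cs Sp hSp (p - μ) w (by rw [hσ]; exact hσpos)
      rw [hσ, sub_dotProduct p μ w, ← hνw] at hcs
      rw [hgps, hg]
      have e1 : (s - a) ^ 2 / (2 * σsq) + 2 * |a| / σsq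
          = 1 / 2 * (((s - a) ^ 2 + 4 * |a|) / σsq) := by
        field_simp
        ring
      rw [e1]
      apply mul_le_mul_of_nonneg_left _ (by norm_num)
      rw [div_le_iff₀ hσpos]
      refine le_trans ?_ hcs
      push Not at hsp
      rcases hs with ⟨h', h⟩ | ⟨h', h⟩ <;> rw [h] at hsp ⊢
      · rw [abs_of_pos h']
        rcases le_abs.1 hp1 with h3 | h3
        · linarith
        · nlinarith
      · rw [abs_of_neg h']
        rcases le_abs.1 hp1 with h3 | h3
        · nlinarith
        · linarith
end

section
/- Let Σ_p ∈ ℝ^{n×n} be positive definite symmetric, V ∈ ℝ^{m×n}, μ ∈ ℝ^n, ν = Vμ with max_{k=1,…,m} |ν_k| < 1. Fix a line ℓ with ν_ℓ ≠ 0 and σ_ℓ² := (V Σ_p Vᵀ)_{ℓℓ} > 0, and let p^{(ℓ)} = μ + ((sign(ν_ℓ)−ν_ℓ)/σ_ℓ²) Σ_p Vᵀ e_ℓ. For ε > 0 let p_ε ~ N(μ, ε Σ_p) and f_ε = V p_ε. Let w ∈ ℝ^n be such that |⟨w, p^{(ℓ)}⟩| > 1. Then the conditional probability ℙ(|⟨w,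 p_ε⟩| ≥ 1 ∣ |(f_ε)_ℓ| ≥ 1) converges to 1 as ε → 0⁺, exponentially fast in 1/ε: there exist c > 0 and ε₀ > 0 such that for all 0 < ε < ε₀, 1 − ℙ(|⟨w, p_ε⟩| ≥ 1 ∣ |(f_ε)_ℓ| ≥ 1) ≤ exp(−c/ε). -/
open Matrix MeasureTheory Filter Topology Set

lemma aux_lower {n : ℕ} (hn : 1 ≤ n) (T : Matrix (Fin n) (Fin n) ℝ) (hT : T.PosDef) :
    ∃ lam : ℝ, 0 < lam ∧ ∀ y : Fin n → ℝ, lam * ‖y‖ ^ 2 ≤ y ⬝ᵥ T.mulVec y := by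
  haveI : Nonempty (Fin n) := ⟨⟨0, hn⟩⟩
  have hc : Continuous fun y : Fin n → ℝ => y ⬝ᵥ T.mulVec y := by fun_prop
  have hne : (Metric.sphere (0 : Fin n → ℝ) 1).Nonempty := NormedSpace.sphere_nonempty.2 zero_le_one
  obtain ⟨z, hz, hmin⟩ := (isCompact_sphere (0 : Fin n → ℝ) 1).exists_isMinOn hne hc.continuousOn
  have hz1 : ‖z‖ = 1 := by simpa using hz
  have hz0 : z ≠ 0 := by
    rintro rfl
    simp at hz1
  refine ⟨z ⬝ᵥ T.mulVec z, ?_, ?_⟩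
  · simpa using hT.dotProduct_mulVec_pos hz0
  · intro y
    by_cases hy : y = 0
    · simp [hy]
    have hy' : 0 < ‖y‖ := norm_pos_iff.2 hy
    have h1 : (‖y‖⁻¹ • y) ∈ Metric.sphere (0 : Fin n → ℝ) 1 := by
      simp [norm_smul, hy'.ne']
    have h2 := hmin h1
    simp only [mem_setOf_eq, Matrix.mulVec_smul, dotProduct_smul, smul_dotProduct, smul_eq_mul] at h2
    have h3 := mul_le_mul_of_nonneg_right h2 (sq_nonneg ‖y‖)
    refine h3.trans (le_of_eq ?_)
    field_simp

lemma aux_integrable {n : ℕ} (hn : 1 ≤ n) (T : Matrix (Fin n) (Fin n) ℝ) (hT : T.PosDef)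
    (μ : Fin n → ℝ) (b : ℝ) (hb : 0 < b) :
    Integrable (fun x : Fin n → ℝ => Real.exp (-b * ((x - μ) ⬝ᵥ T.mulVec (x - μ)))) := by
  obtain ⟨lam, hl, h⟩ := aux_lower hn T hT
  have hn' : (0 : ℝ) < n := by exact_mod_cast hn
  have key : Integrable (fun y : Fin n → ℝ => Real.exp (-b * (y ⬝ᵥ T.mulVec y))) := by
    have hg : Integrable (fun y : Fin n → ℝ => ∏ i, Real.exp (-(b * lam / n) * (y i) ^ 2)) :=
      Integrable.fintype_prod (f := fun _ (t : ℝ) => Real.exp (-(b * lam / n) * t ^ 2))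
        (fun i => integrable_exp_neg_mul_sq (by positivity))
    refine hg.mono' (Continuous.aestronglyMeasurable (by fun_prop)) (ae_of_all _ fun y => ?_)
    rw [Real.norm_eq_abs, Real.abs_exp, ← Real.exp_sum, ← Finset.mul_sum]
    apply Real.exp_le_exp.2
    have h1 : ∑ i, (y i) ^ 2 ≤ n * ‖y‖ ^ 2 := by
      calc ∑ i, (y i) ^ 2 ≤ ∑ i : Fin n, ‖y‖ ^ 2 := by
            apply Finset.sum_le_sum
            intro i _
            have := norm_le_pi_norm y i
            rw [← sq_abs]
            gcongr
            simpa using this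
        _ = n * ‖y‖ ^ 2 := by simp
    have h2 := h y
    have h3 : b * lam / n * ∑ i, (y i) ^ 2 ≤ b * lam / n * (n * ‖y‖ ^ 2) := by gcongr
    have h4 : b * lam / n * (n * ‖y‖ ^ 2) = b * (lam * ‖y‖ ^ 2) := by field_simp
    have h5 := mul_le_mul_of_nonneg_left h2 hb.le
    linarith
  exact key.comp_sub_right μ

/-- Completing the square. -/
lemma aux_square {n : ℕ} (Sp : Matrix (Fin n) (Fin n) ℝ) (hSp : Sp.PosDef) (a : Fin n → ℝ)
    (s : ℝ) (hs : s = a ⬝ᵥ Sp.mulVec a) (hs0 : 0 < s) (y : Fin n → ℝ) :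
    y ⬝ᵥ Sp⁻¹.mulVec y = (a ⬝ᵥ y) ^ 2 / s +
      (y - ((a ⬝ᵥ y) / s) • Sp.mulVec a) ⬝ᵥ Sp⁻¹.mulVec (y - ((a ⬝ᵥ y) / s) • Sp.mulVec a) := by
  have hdet : IsUnit Sp.det := hSp.isUnit.map Matrix.detMonoidHom
  have hinv : Sp⁻¹.mulVec (Sp.mulVec a) = a := by
    rw [Matrix.mulVec_mulVec, Matrix.nonsing_inv_mul _ hdet, Matrix.one_mulVec]
  have hsymm : Sp⁻¹ᵀ = Sp⁻¹ := by
    have := hSp.inv.isHermitian.eq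
    rwa [Matrix.conjTranspose_eq_transpose_of_trivial] at this
  have h2 : Sp.mulVec a ⬝ᵥ Sp⁻¹.mulVec y = a ⬝ᵥ y := by
    rw [Matrix.dotProduct_mulVec, ← Matrix.mulVec_transpose, hsymm, hinv]
  have h3 : Sp.mulVec a ⬝ᵥ a = s := by rw [hs, dotProduct_comm]
  have h4 : y ⬝ᵥ a = a ⬝ᵥ y := dotProduct_comm _ _
  simp only [Matrix.mulVec_sub, Matrix.mulVec_smul, dotProduct_sub, sub_dotProduct, dotProduct_smul,
    smul_dotProduct, smul_eq_mul, hinv, h2, h3, h4]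
  field_simp
  ring

lemma aux_scalar (v t : ℝ) (hv : |v| < 1) (hv0 : v ≠ 0) (ht : 1 ≤ |t|) :
    (sgn v - v) ^ 2 ≤ (t - v) ^ 2 ∧ ((t - v) ^ 2 = (sgn v - v) ^ 2 → t = sgn v) := by
  rw [abs_lt] at hv
  unfold sgn
  rcases lt_or_gt_of_ne hv0 with h | h
  · rw [if_neg (not_le.2 h)]
    rcases le_abs.1 ht with h1 | h1
    · exact ⟨by nlinarith, fun _ => by nlinarith⟩
    · exact ⟨by nlinarith, fun _ => by nlinarith⟩
  · rw [if_pos h.le]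
    rcases le_abs.1 ht with h1 | h1
    · exact ⟨by nlinarith, fun _ => by nlinarith⟩
    · exact ⟨by nlinarith, fun _ => by nlinarith⟩

/-- Laplace type bound. -/
lemma aux_laplace {n : ℕ} (Q : (Fin n → ℝ) → ℝ) (hQ : Continuous Q)
    (hint : ∀ b : ℝ, 0 < b → Integrable fun x => Real.exp (-b * Q x))
    (A B : Set (Fin n → ℝ)) (hA : MeasurableSet A) (hB : MeasurableSet B)
    (q δ : ℝ) (hδ : 0 < δ) (hBQ : ∀ x ∈ B, q + 2 * δ ≤ Q x)
    (hAQ : ∃ x ∈ interior A, Q x < q + δ) :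
    ∃ c : ℝ, 0 < c ∧ ∃ ε₀ : ℝ, 0 < ε₀ ∧ ∀ ε : ℝ, 0 < ε → ε < ε₀ →
      0 < ∫ x in A, Real.exp (-(1 / (2 * ε)) * Q x) ∧
      (∫ x in B, Real.exp (-(1 / (2 * ε)) * Q x)) ≤ Real.exp (-c / ε) *
        ∫ x in A, Real.exp (-(1 / (2 * ε)) * Q x) := by
  obtain ⟨x₀, hx₀, hx₀Q⟩ := hAQ
  set U : Set (Fin n → ℝ) := (interior A ∩ {x | Q x < q + δ}) ∩ Metric.ball x₀ 1 with hU
  have hUo : IsOpen U :=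
    (isOpen_interior.inter (isOpen_lt hQ continuous_const)).inter Metric.isOpen_ball
  have hUne : U.Nonempty := ⟨x₀, ⟨hx₀, hx₀Q⟩, Metric.mem_ball_self one_pos⟩
  have hUpos : 0 < volume U := hUo.measure_pos _ hUne
  have hUfin : volume U < ⊤ := (measure_mono inter_subset_right).trans_lt measure_ball_lt_top
  have hUA : U ⊆ A := fun x hx => interior_subset hx.1.1
  have hvpos : 0 < (volume U).toReal := ENNReal.toReal_pos hUpos.ne' hUfin.ne
  set vU := (volume U).toReal with hvU
  have low : ∀ ε : ℝ, 0 < ε → Real.exp (-(1 / (2 * ε)) * (q + δ)) * vU ≤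
      ∫ x in A, Real.exp (-(1 / (2 * ε)) * Q x) := by
    intro ε hε
    have hi := hint (1 / (2 * ε)) (by positivity)
    calc Real.exp (-(1 / (2 * ε)) * (q + δ)) * vU
        = ∫ x in U, Real.exp (-(1 / (2 * ε)) * (q + δ)) := by
          rw [setIntegral_const, smul_eq_mul, mul_comm]; rfl
      _ ≤ ∫ x in U, Real.exp (-(1 / (2 * ε)) * Q x) := by
          apply setIntegral_mono_on _ hi.integrableOn hUo.measurableSet
          · intro x hx
            apply Real.exp_le_exp.2
            have h1 : Q x ≤ q + δ := le_of_lt hx.1.2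
            have h2 : 0 ≤ 1 / (2 * ε) := by positivity
            nlinarith
          · exact integrableOn_const hUfin.ne
      _ ≤ _ := setIntegral_mono_set hi.integrableOn
          (ae_of_all _ fun x => (Real.exp_pos _).le) (HasSubset.Subset.eventuallyLE hUA)
  set C := ∫ x, Real.exp (-(1 / 2) * Q x) with hC
  have hC0 : 0 ≤ C := integral_nonneg fun x => (Real.exp_pos _).le
  have up : ∀ ε : ℝ, 0 < ε → ε < 1 → (∫ x in B, Real.exp (-(1 / (2 * ε)) * Q x)) ≤
      Real.exp (-(1 / (2 * ε) - 1 / 2) * (q + 2 * δ)) * C := by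
    intro ε hε hε1
    have hi := hint (1 / (2 * ε)) (by positivity)
    have hi1 := hint (1 / 2) (by positivity)
    calc (∫ x in B, Real.exp (-(1 / (2 * ε)) * Q x))
        ≤ ∫ x in B, Real.exp (-(1 / (2 * ε) - 1 / 2) * (q + 2 * δ)) * Real.exp (-(1 / 2) * Q x) := by
          apply setIntegral_mono_on hi.integrableOn (hi1.const_mul _).integrableOn hB
          intro x hx
          rw [← Real.exp_add]
          apply Real.exp_le_exp.2
          have h1 := hBQ x hx
          have h2 : 0 ≤ 1 / (2 * ε) - 1 / 2 := by
            rw [sub_nonneg]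
            apply one_div_le_one_div_of_le <;> linarith
          nlinarith
      _ ≤ ∫ x, Real.exp (-(1 / (2 * ε) - 1 / 2) * (q + 2 * δ)) * Real.exp (-(1 / 2) * Q x) :=
          setIntegral_le_integral (hi1.const_mul _) (ae_of_all _ fun x => by positivity)
      _ = _ := integral_const_mul _ _
  -- constants
  set D := Real.exp ((q + 2 * δ) / 2) * C / vU + 1 with hD
  have hD1 : 1 ≤ D := by
    have : 0 ≤ Real.exp ((q + 2 * δ) / 2) * C / vU := by positivity
    linarith
  have hD0 : 0 ≤ Real.log D := Real.log_nonneg hD1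
  refine ⟨δ / 4, by positivity, min 1 (δ / 4 / (Real.log D + 1)), by positivity, ?_⟩
  intro ε hε hε0
  have hε1 := hε0.trans_le (min_le_left _ _)
  have hε2 := hε0.trans_le (min_le_right _ _)
  refine ⟨lt_of_lt_of_le (by positivity) (low ε hε), (up ε hε hε1).trans ?_⟩
  refine le_trans ?_ (mul_le_mul_of_nonneg_left (low ε hε) (Real.exp_pos _).le)
  have hDle : D ≤ Real.exp (δ / 4 / ε) := by
    rw [← Real.log_le_iff_le_exp (by linarith)]
    rw [lt_div_iff₀ (by positivity)] at hε2
    rw [le_div_iff₀ hε]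
    nlinarith
  have e1 : Real.exp ((q + 2 * δ) / 2) * C ≤ D * vU := by
    rw [hD, add_mul, div_mul_cancel₀ _ hvpos.ne']
    linarith
  calc Real.exp (-(1 / (2 * ε) - 1 / 2) * (q + 2 * δ)) * C
      = Real.exp (-(1 / (2 * ε)) * (q + 2 * δ)) * (Real.exp ((q + 2 * δ) / 2) * C) := by
        rw [← mul_assoc, ← Real.exp_add]; congr 2; ring
    _ ≤ Real.exp (-(1 / (2 * ε)) * (q + 2 * δ)) * (Real.exp (δ / 4 / ε) * vU) := by
        apply mul_le_mul_of_nonneg_left _ (Real.exp_pos _).le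
        exact e1.trans (mul_le_mul_of_nonneg_right hDle hvpos.le)
    _ = _ := by
        rw [← mul_assoc, ← mul_assoc, ← Real.exp_add, ← Real.exp_add]
        congr 2
        field_simp
        ring

lemma aux_mv {n : ℕ} (hn : 1 ≤ n) (Sp : Matrix (Fin n) (Fin n) ℝ) (hSp : Sp.PosDef)
    (μ : Fin n → ℝ) (ε : ℝ) (hε : 0 < ε) :
    ∃ K : ℝ, 0 < K ∧ ∀ S : Set (Fin n → ℝ), MeasurableSet S →
      (mvGaussian μ (ε • Sp) S).toReal =
        K * ∫ x in S, Real.exp (-(1 / (2 * ε)) * ((x - μ) ⬝ᵥ Sp⁻¹.mulVec (x - μ))) := by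
  have hdet : 0 < (ε • Sp).det := (hSp.smul hε).det_pos
  have hinv : (ε • Sp)⁻¹ = ε⁻¹ • Sp⁻¹ := by
    apply Matrix.inv_eq_left_inv
    rw [Matrix.smul_mul, Matrix.mul_smul, Matrix.nonsing_inv_mul _ hSp.det_pos.ne'.isUnit, smul_smul,
      inv_mul_cancel₀ hε.ne', one_smul]
  refine ⟨(Real.sqrt ((2 * Real.pi) ^ n * (ε • Sp).det))⁻¹, by positivity, ?_⟩
  intro S hS
  rw [mvGaussian, withDensity_apply _ hS, ← integral_const_mul,
    integral_eq_lintegral_of_nonneg_ae (ae_of_all _ fun x => by positivity)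
      (Continuous.aestronglyMeasurable (by fun_prop))]
  congr 1
  apply lintegral_congr
  intro x
  congr 3
  rw [hinv, Matrix.smul_mulVec, dotProduct_smul, smul_eq_mul]
  field_simp

/-- Second part of Proposition 3: if the most likely post-failure flow `⟨w, p^{(ℓ)}⟩` exceeds the
threshold, i.e. `|⟨w, p^{(ℓ)}⟩| > 1`, then the conditional probability of the subsequent failure
`|⟨w, p_ε⟩| ≥ 1`, given `|(f_ε)_ℓ| ≥ 1`, converges to `1` exponentially fast in `1/ε`. -/
theorem conditional_subsequent_failure (n m : ℕ) (hn : 1 ≤ n) (hm : 1 ≤ m)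
    (Sp : Matrix (Fin n) (Fin n) ℝ) (hSp : Sp.PosDef)
    (V : Matrix (Fin m) (Fin n) ℝ) (μ : Fin n → ℝ)
    (ν : Fin m → ℝ) (hν : ν = V.mulVec μ)
    (hνlt : ∀ k : Fin m, |ν k| < 1)
    (ℓ : Fin m) (hℓ0 : ν ℓ ≠ 0)
    (σsq : ℝ) (hσdef : σsq = (V * Sp * Vᵀ) ℓ ℓ) (hσpos : 0 < σsq)
    (pstar : Fin n → ℝ)
    (hpstar : pstar = μ + ((sgn (ν ℓ) - ν ℓ) / σsq) • Sp.mulVec (Vᵀ.mulVec (Pi.single ℓ 1)))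
    (w : Fin n → ℝ) (hw : 1 < |w ⬝ᵥ pstar|) :
    Tendsto (fun ε : ℝ =>
        (mvGaussian μ (ε • Sp) ({x | 1 ≤ |w ⬝ᵥ x|} ∩ {x | 1 ≤ |V.mulVec x ℓ|})).toReal /
          (mvGaussian μ (ε • Sp) {x | 1 ≤ |V.mulVec x ℓ|}).toReal)
      (𝓝[>] (0 : ℝ)) (𝓝 1) ∧
    ∃ c : ℝ, 0 < c ∧ ∃ ε₀ : ℝ, 0 < ε₀ ∧ ∀ ε : ℝ, 0 < ε → ε < ε₀ →
      1 - (mvGaussian μ (ε • Sp) ({x | 1 ≤ |w ⬝ᵥ x|} ∩ {x | 1 ≤ |V.mulVec x ℓ|})).toReal /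
            (mvGaussian μ (ε • Sp) {x | 1 ≤ |V.mulVec x ℓ|}).toReal ≤
        Real.exp (-c / ε) := by
  have hsigma : σsq = V ℓ ⬝ᵥ Sp.mulVec (V ℓ) := by
    rw [hσdef, Matrix.mul_assoc, Matrix.mul_apply, dotProduct]
    rfl
  have hrow : Vᵀ.mulVec (Pi.single ℓ 1) = V ℓ := by
    ext i
    simp
  rw [hrow] at hpstar
  have hf : ∀ x : Fin n → ℝ, V.mulVec x ℓ = V ℓ ⬝ᵥ x := fun x => rfl
  simp only [hf]
  have hνℓ : ν ℓ = V ℓ ⬝ᵥ μ := by rw [hν]; rfl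
  set a := V ℓ with ha
  set v := ν ℓ with hv
  have hvlt : |v| < 1 := hνlt ℓ
  have hTpd : (Sp⁻¹).PosDef := hSp.inv
  set Q : (Fin n → ℝ) → ℝ := fun x => (x - μ) ⬝ᵥ Sp⁻¹.mulVec (x - μ) with hQdef
  have hQc : Continuous Q := by fun_prop
  set A : Set (Fin n → ℝ) := {x | 1 ≤ |a ⬝ᵥ x|} with hAdef
  set W : Set (Fin n → ℝ) := {x | 1 ≤ |w ⬝ᵥ x|} with hWdef
  have hAcl : IsClosed A := isClosed_le continuous_const (by fun_prop)
  have hWcl : IsClosed W := isClosed_le continuous_const (by fun_prop)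
  set q := (sgn v - v) ^ 2 / σsq with hq
  -- the quadratic form is strictly above `q` on `A` away from `pstar`
  have hQstrict : ∀ x ∈ A, x ≠ pstar → q < Q x := by
    intro x hx hne
    have hsq := aux_square Sp hSp a σsq hsigma hσpos (x - μ)
    rw [dotProduct_sub, ← hνℓ] at hsq
    obtain ⟨h1, h2⟩ := aux_scalar v (a ⬝ᵥ x) hvlt hℓ0 hx
    have h3 : q ≤ (a ⬝ᵥ x - v) ^ 2 / σsq := by rw [hq]; gcongr
    set z := x - μ - ((a ⬝ᵥ x - v) / σsq) • Sp.mulVec a with hz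
    by_cases hz0 : z = 0
    · have hxt : a ⬝ᵥ x ≠ sgn v := by
        intro ht
        apply hne
        rw [hpstar, ← ht]
        rw [hz, sub_sub, sub_eq_zero] at hz0
        exact hz0
      have h4 : (sgn v - v) ^ 2 < (a ⬝ᵥ x - v) ^ 2 :=
        lt_of_le_of_ne h1 fun h => hxt (h2 h.symm)
      have h5 : q < (a ⬝ᵥ x - v) ^ 2 / σsq := by rw [hq]; gcongr
      have h6 : Q x = (a ⬝ᵥ x - v) ^ 2 / σsq := by
        simp only [hQdef]
        rw [hsq, hz0]; simp
      rw [h6]; exact h5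
    · have h7 : 0 < z ⬝ᵥ Sp⁻¹.mulVec z := by simpa using hTpd.dotProduct_mulVec_pos hz0
      have h6 : Q x = (a ⬝ᵥ x - v) ^ 2 / σsq + z ⬝ᵥ Sp⁻¹.mulVec z := hsq
      linarith
  have hline : ∀ t : ℝ, Q (μ + (t / σsq) • Sp.mulVec a) = t ^ 2 / σsq ∧
      a ⬝ᵥ (μ + (t / σsq) • Sp.mulVec a) = v + t := by
    intro t
    have h0 : a ⬝ᵥ ((t / σsq) • Sp.mulVec a) = t := by
      rw [dotProduct_smul, ← hsigma, smul_eq_mul, div_mul_cancel₀ _ hσpos.ne']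
    constructor
    · have hsq := aux_square Sp hSp a σsq hsigma hσpos ((t / σsq) • Sp.mulVec a)
      rw [h0, sub_self] at hsq
      simp only [hQdef, add_sub_cancel_left]
      rw [hsq]; simp
    · rw [dotProduct_add, h0, hνℓ]
  -- gap on the complement
  have hgap : ∃ δ : ℝ, 0 < δ ∧ ∀ x ∈ A \ W, q + 2 * δ ≤ Q x := by
    set B : Set (Fin n → ℝ) := A ∩ {x | |w ⬝ᵥ x| ≤ 1} with hB
    have hBcl : IsClosed B := hAcl.inter (isClosed_le (by fun_prop) continuous_const)
    have hsub : A \ W ⊆ B := by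
      intro x hx
      have h : ¬ 1 ≤ |w ⬝ᵥ x| := hx.2
      have h' : |w ⬝ᵥ x| ≤ 1 := (not_le.1 h).le
      exact ⟨hx.1, h'⟩
    rcases B.eq_empty_or_nonempty with he | ⟨x₁, hx₁⟩
    · refine ⟨1, one_pos, fun x hx => ?_⟩
      have := hsub hx
      rw [he] at this
      exact this.elim
    · have hcoer : Tendsto Q (cocompact (Fin n → ℝ)) atTop := by
        obtain ⟨lam, hl, h⟩ := aux_lower hn Sp⁻¹ hTpd
        have h1 : Tendsto (fun x : Fin n → ℝ => ‖x - μ‖) (cocompact _) atTop :=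
          tendsto_norm_cocompact_atTop.comp
            ((Homeomorph.subRight μ).isClosedEmbedding.tendsto_cocompact)
        have h2 := ((tendsto_pow_atTop two_ne_zero).comp h1).const_mul_atTop hl
        exact tendsto_atTop_mono (fun x => h (x - μ)) h2
      obtain ⟨x₂, hx₂, hmin⟩ := hQc.continuousOn.exists_isMinOn' hBcl hx₁
        ((hcoer.eventually_ge_atTop (Q x₁)).filter_mono inf_le_left)
      have h1 : q < Q x₂ := by
        apply hQstrict x₂ hx₂.1
        rintro rfl
        exact absurd hx₂.2 (not_le.2 hw)
      refine ⟨(Q x₂ - q) / 2, by linarith, fun x hx => ?_⟩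
      have : Q x₂ ≤ Q x := hmin (hsub hx)
      linarith
  obtain ⟨δ, hδ, hgap⟩ := hgap
  have hnear : ∃ x ∈ interior A, Q x < q + δ := by
    have hcont : Continuous fun s : ℝ => (s * sgn v - v) ^ 2 / σsq := by fun_prop
    have h1 : ∀ᶠ s in 𝓝[>] (1 : ℝ), (s * sgn v - v) ^ 2 / σsq < q + δ := by
      apply (hcont.tendsto 1).mono_left nhdsWithin_le_nhds |>.eventually_lt_const
      rw [one_mul]
      linarith
    obtain ⟨s, hs1, hs2⟩ := (h1.and self_mem_nhdsWithin).exists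
    have hs2 : 1 < s := hs2
    obtain ⟨e1, e2⟩ := hline (s * sgn v - v)
    refine ⟨_, ?_, e1.trans_lt hs1⟩
    have hopen : IsOpen {x : Fin n → ℝ | 1 < |a ⬝ᵥ x|} := isOpen_lt continuous_const (by fun_prop)
    have hsubA : {x : Fin n → ℝ | 1 < |a ⬝ᵥ x|} ⊆ A := by
      intro x hx
      have h : 1 < |a ⬝ᵥ x| := hx
      exact h.le
    apply interior_maximal hsubA hopen
    have hsg : |sgn v| = 1 := by
      unfold sgn
      split_ifs <;> simp
    rw [mem_setOf_eq, e2, add_sub_cancel, abs_mul, hsg, mul_one]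
    exact hs2.trans_le (le_abs_self s)
  have hint : ∀ b : ℝ, 0 < b → Integrable fun x => Real.exp (-b * Q x) :=
    fun b hb => aux_integrable hn Sp⁻¹ hTpd μ b hb
  obtain ⟨c, hc, ε₀, hε₀, hmain⟩ := aux_laplace Q hQc hint A (A \ W) hAcl.measurableSet
    (hAcl.measurableSet.diff hWcl.measurableSet) q δ hδ hgap hnear
  have hkey : ∀ ε : ℝ, 0 < ε → ε < ε₀ →
      1 - (mvGaussian μ (ε • Sp) (W ∩ A)).toReal / (mvGaussian μ (ε • Sp) A).toReal ≤
        Real.exp (-c / ε) ∧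
      (mvGaussian μ (ε • Sp) (W ∩ A)).toReal / (mvGaussian μ (ε • Sp) A).toReal ≤ 1 := by
    intro ε hε hε0
    obtain ⟨hpos, hle⟩ := hmain ε hε hε0
    obtain ⟨K, hK, hKeq⟩ := aux_mv hn Sp hSp μ ε hε
    rw [hKeq _ (hWcl.inter hAcl).measurableSet, hKeq _ hAcl.measurableSet,
      mul_div_mul_left _ _ hK.ne']
    have hsplit := integral_inter_add_diff (μ := volume) (s := A) (t := W) hWcl.measurableSet
      (hint (1 / (2 * ε)) (by positivity)).integrableOn
    rw [inter_comm A W] at hsplit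
    have hnn : 0 ≤ ∫ x in A \ W, Real.exp (-(1 / (2 * ε)) * Q x) :=
      integral_nonneg fun x => (Real.exp_pos _).le
    change 1 - (∫ x in W ∩ A, Real.exp (-(1 / (2 * ε)) * Q x)) /
      (∫ x in A, Real.exp (-(1 / (2 * ε)) * Q x)) ≤ _ ∧
      (∫ x in W ∩ A, Real.exp (-(1 / (2 * ε)) * Q x)) /
      (∫ x in A, Real.exp (-(1 / (2 * ε)) * Q x)) ≤ 1
    constructor
    · rw [sub_le_comm, le_div_iff₀ hpos]
      linarith
    · rw [div_le_one hpos]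
      linarith
  refine ⟨?_, c, hc, ε₀, hε₀, fun ε h1 h2 => (hkey ε h1 h2).1⟩
  have hev : ∀ᶠ ε in 𝓝[>] (0 : ℝ), 0 < ε ∧ ε < ε₀ := Ioo_mem_nhdsGT hε₀
  have hexp : Tendsto (fun ε : ℝ => 1 - Real.exp (-c / ε)) (𝓝[>] 0) (𝓝 1) := by
    have h1 : Tendsto (fun ε : ℝ => -c / ε) (𝓝[>] 0) atBot := by
      simp only [div_eq_mul_inv]
      exact tendsto_inv_nhdsGT_zero.const_mul_atTop_of_neg (by linarith)
    simpa using (Real.tendsto_exp_atBot.comp h1).const_sub 1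
  refine tendsto_of_tendsto_of_tendsto_of_le_of_le' hexp tendsto_const_nhds ?_ ?_
  · filter_upwards [hev] with ε hε
    have := (hkey ε hε.1 hε.2).1
    linarith
  · filter_upwards [hev] with ε hε
    exact (hkey ε hε.1 hε.2).2
end
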